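/- arXiv:2305.09818 — 3 statements merged into one kernel-verified Lean document; each statement's English description precedes it below -/
import Mathlib

section
/- Every group of F-type is coherent: every finitely generated subgroup of a group of F-type admits a finite presentation. -/
open scoped MatrixGroups

namespace FPaper

/-- A (reduced) word in a free group is *cyclically reduced* if its first letter is not the
formal inverse of its last letter. -/
def CyclicallyReduced {α : Type*} [DecidableEq α] (w : FreeGroup α) : Prop :=
  ∀ x y : α × Bool, w.toWord.head? = some x → w.toWord.getLast? = some y →
    x.1 = y.1 → x.2 = y.2

/-- The combinatorial data of a presentation of F-type:
`⟨a_1, …, a_n ∣ a_1^{e_1} = ⋯ = a_n^{e_n} = U V = 1⟩` with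
`U = U(a_1, …, a_p)` and `V = V(a_{p+1}, …, a_n)`. -/
structure FTypeBase where
  n : ℕ
  e : Fin n → ℕ
  p : ℕ
  U : FreeGroup (Fin n)
  V : FreeGroup (Fin n)

namespace FTypeBase

/-- Relators of the full F-type presentation. -/
def rels (D : FTypeBase) : Set (FreeGroup (Fin D.n)) :=
  {w | ∃ i : Fin D.n, w = FreeGroup.of i ^ D.e i} ∪ {D.U * D.V}

/-- Relators presenting the first factor `G₁` (the generators `a_{p+1}, …, a_n` are killed), so
that `PresentedGroup D.rels1` is the free product of cyclics on `a_1, …, a_p`. -/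
def rels1 (D : FTypeBase) : Set (FreeGroup (Fin D.n)) :=
  {w | ∃ i : Fin D.n, (i : ℕ) < D.p ∧ w = FreeGroup.of i ^ D.e i} ∪
    {w | ∃ i : Fin D.n, D.p ≤ (i : ℕ) ∧ w = FreeGroup.of i}

/-- Relators presenting the second factor `G₂` (the generators `a_1, …, a_p` are killed), so
that `PresentedGroup D.rels2` is the free product of cyclics on `a_{p+1}, …, a_n`. -/
def rels2 (D : FTypeBase) : Set (FreeGroup (Fin D.n)) :=
  {w | ∃ i : Fin D.n, D.p ≤ (i : ℕ) ∧ w = FreeGroup.of i ^ D.e i} ∪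
    {w | ∃ i : Fin D.n, (i : ℕ) < D.p ∧ w = FreeGroup.of i}

/-- The group presented by the F-type presentation. -/
abbrev Gp (D : FTypeBase) := PresentedGroup D.rels

/-- The first factor `G₁ = ⟨a_1, …, a_p ∣ a_1^{e_1} = ⋯ = a_p^{e_p} = 1⟩`. -/
abbrev Gp1 (D : FTypeBase) := PresentedGroup D.rels1

/-- The second factor `G₂ = ⟨a_{p+1}, …, a_n ∣ a_{p+1}^{e_{p+1}} = ⋯ = a_n^{e_n} = 1⟩`. -/
abbrev Gp2 (D : FTypeBase) := PresentedGroup D.rels2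

/-- The image of the word `U` in the first factor `G₁`. -/
def imgU1 (D : FTypeBase) : D.Gp1 := PresentedGroup.mk D.rels1 D.U

/-- The image of the word `V` in the second factor `G₂`. -/
def imgV2 (D : FTypeBase) : D.Gp2 := PresentedGroup.mk D.rels2 D.V

/-- The conditions making an F-type presentation: `n ≥ 2`; each `e_i` is `0` or `≥ 2`;
`1 ≤ p ≤ n - 1`; `U` is a cyclically reduced word in `a_1, …, a_p` of infinite order in `G₁`;
`V` is a cyclically reduced word in `a_{p+1}, …, a_n` of infinite order in `G₂`; and if
`p = 1` (resp. `p = n - 1`) then `U = a_1^m` (resp. `V = a_n^m`) for some `m ≥ 2`. -/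
def IsFType (D : FTypeBase) : Prop :=
  2 ≤ D.n ∧ (∀ i, D.e i = 0 ∨ 2 ≤ D.e i) ∧ 1 ≤ D.p ∧ D.p ≤ D.n - 1 ∧
  (∀ x ∈ D.U.toWord, (x.1 : ℕ) < D.p) ∧ (∀ x ∈ D.V.toWord, D.p ≤ (x.1 : ℕ)) ∧
  CyclicallyReduced D.U ∧ CyclicallyReduced D.V ∧
  ¬ IsOfFinOrder D.imgU1 ∧ ¬ IsOfFinOrder D.imgV2 ∧
  (D.p = 1 → ∃ (i : Fin D.n) (m : ℕ), (i : ℕ) = 0 ∧ 2 ≤ m ∧ D.U = FreeGroup.of i ^ m) ∧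
  (D.p = D.n - 1 → ∃ (i : Fin D.n) (m : ℕ), (i : ℕ) = D.n - 1 ∧ 2 ≤ m ∧ D.V = FreeGroup.of i ^ m)

/-- The subgroup of the F-type group generated by (the images of) `a_1, …, a_p`. -/
def factor1 (D : FTypeBase) : Subgroup D.Gp :=
  Subgroup.closure {g | ∃ i : Fin D.n, (i : ℕ) < D.p ∧ g = PresentedGroup.of i}

/-- The subgroup of the F-type group generated by (the images of) `a_{p+1}, …, a_n`. -/
def factor2 (D : FTypeBase) : Subgroup D.Gp :=
  Subgroup.closure {g | ∃ i : Fin D.n, D.p ≤ (i : ℕ) ∧ g = PresentedGroup.of i}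

/-- The amalgamated subgroup `A = ⟨U⟩ = ⟨V⟩` of the F-type group. -/
def amalg (D : FTypeBase) : Subgroup D.Gp :=
  Subgroup.zpowers (PresentedGroup.mk D.rels D.U)

end FTypeBase

/-- A group is *of F-type* if it is isomorphic to the group of some F-type presentation. -/
def IsFTypeGroup (G : Type*) [Group G] : Prop :=
  ∃ D : FTypeBase, D.IsFType ∧ Nonempty (G ≃* D.Gp)

/-- An element of a group is a *proper power* if it equals `h ^ k` for some `k ≥ 2`. -/
def IsProperPower {G : Type*} [Group G] (g : G) : Prop :=
  ∃ (h : G) (k : ℕ), 2 ≤ k ∧ g = h ^ k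

/-- A group is a *free product of cyclic groups* if it has a presentation in which every
relator is a power of a generator. -/
def IsFreeProductOfCyclics (H : Type*) [Group H] : Prop :=
  ∃ (ι : Type) (e : ι → ℕ),
    Nonempty (H ≃* PresentedGroup {w : FreeGroup ι | ∃ i : ι, w = FreeGroup.of i ^ e i})

/-- A subgroup `K` of `H` is *malnormal* if `g K g⁻¹ ∩ K = {1}` for every `g ∉ K`. -/
def IsMalnormal {H : Type*} [Group H] (K : Subgroup H) : Prop :=
  ∀ g : H, g ∉ K → ∀ x ∈ K, g * x * g⁻¹ ∈ K → x = 1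

end FPaper

namespace FPaper

/-- A group is finitely presented if it is isomorphic to a group presented by finitely many
generators and finitely many relators. -/
def IsFinitelyPresented (H : Type*) [Group H] : Prop :=
  ∃ (m : ℕ) (rels : Set (FreeGroup (Fin m))), rels.Finite ∧ Nonempty (H ≃* PresentedGroup rels)

theorem _root_.Subgroup.FG.map' {G G' : Type*} [Group G] [Group G'] {H : Subgroup G}
    (hH : H.FG) (f : G →* G') : (H.map f).FG :=
  (Subgroup.fg_iff_submonoid_fg _).2 (((Subgroup.fg_iff_submonoid_fg H).1 hH).map f)

/-- A group is coherent if its finitely generated subgroups are finitely presented. -/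
def Coherent (G : Type*) [Group G] : Prop :=
  ∀ H : Subgroup G, H.FG → Group.IsFinitelyPresented H

theorem Coherent.of_injective {G G' : Type*} [Group G] [Group G'] (hG : Coherent G)
    (f : G' →* G) (hf : Function.Injective f) : Coherent G' := fun H hH =>
  have := hG (H.map f) (hH.map' f)
  Group.IsFinitelyPresented.equiv (H.equivMapOfInjective f hf).symm

theorem Coherent.of_isCyclic (G : Type*) [Group G] [IsCyclic G] : Coherent G := fun H _ => by
  rcases finite_or_infinite H with _ | _
  · infer_instance
  · exact Group.IsFinitelyPresented.equiv intCyclicMulEquiv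

/-- `G` is the amalgam of its subgroups `M i` along `A`: the `M i` generate `G`, and no
nonempty reduced product lies in `A`. -/
structure IsAmalgam {ι G : Type*} [Group G] (M : ι → Subgroup G) (A : Subgroup G) : Prop where
  le : ∀ i, A ≤ M i
  iSup_eq_top : ⨆ i, M i = ⊤
  prod_notMem : ∀ l : List (ι × G), l ≠ [] → l.IsChain (fun x y => x.1 ≠ y.1) →
    (∀ x ∈ l, x.2 ∈ M x.1 ∧ x.2 ∉ A) → (l.map Prod.snd).prod ∉ A

/-! ### Paths in a graph of groups -/

section Paths

variable {ι G P : Type*} [Group G] [Group P]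

/-- Compositions of steps; `p` and `h` record the product of the labels in `P` and `G`. -/
inductive StepPath (Step : ι → G → G → P → G → Prop) : G → G → P → G → Prop
  | nil (e) : StepPath Step e e 1 1
  | cons {i e e' e'' p h p' h'} : Step i e e' p h → StepPath Step e' e'' p' h' →
      StepPath Step e e'' (p * p') (h * h')

theorem StepPath.single {Step : ι → G → G → P → G → Prop} {i e e' p h}
    (hs : Step i e e' p h) : StepPath Step e e' p h := by
  simpa using StepPath.cons hs (StepPath.nil e')

theorem StepPath.append {Step : ι → G → G → P → G → Prop} {e e' e'' p h p' h'}
    (h₁ : StepPath Step e e' p h) (h₂ : StepPath Step e' e'' p' h') :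
    StepPath Step e e'' (p * p') (h * h') := by
  induction h₁ with
  | nil => simpa using h₂
  | cons hs _ ih => simpa only [mul_assoc] using StepPath.cons hs (ih h₂)

/-- Paths can be relabelled step by step. -/
theorem StepPath.lift {P' : Type*} [Group P'] {Step : ι → G → G → P → G → Prop}
    {Step' : ι → G → G → P' → G → Prop}
    (H : ∀ {i e e' p h}, Step i e e' p h → ∃ p', Step' i e e' p' h) {e e' p h}
    (hp : StepPath Step e e' p h) : ∃ p', StepPath Step' e e' p' h := by
  induction hp with
  | nil e => exact ⟨1, .nil e⟩
  | cons hs _ ih =>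
    obtain ⟨q, hq⟩ := H hs
    obtain ⟨q', hq'⟩ := ih
    exact ⟨_, .cons hq hq'⟩

theorem StepPath.map {P' : Type*} [Group P'] (f : P →* P')
    {Step : ι → G → G → P → G → Prop} {Step' : ι → G → G → P' → G → Prop}
    (H : ∀ {i e e' p h}, Step i e e' p h → Step' i e e' (f p) h) {e e' p h}
    (hp : StepPath Step e e' p h) : StepPath Step' e e' (f p) h := by
  induction hp with
  | nil e => simpa using StepPath.nil e
  | cons hs _ ih => simpa using StepPath.cons (H hs) ih

theorem StepPath.map_eq {Step : ι → G → G → P → G → Prop} (π : P →* G)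
    (H : ∀ {i e e' p h}, Step i e e' p h → π p = h) {e e' p h}
    (hp : StepPath Step e e' p h) : π p = h := by
  induction hp with
  | nil e => simp
  | cons hs _ ih => simp [H hs, ih]

/-- Reduced paths: consecutive indices differ and no step lies in the amalgamated subgroup. The
first argument is the index of the initial step. -/
inductive ReducedPath (A : Subgroup G) (Step : ι → G → G → P → G → Prop) :
    ι → G → G → P → G → Prop
  | single {i e e' p h} : Step i e e' p h → e⁻¹ * h * e' ∉ A → ReducedPath A Step i e e' p h
  | cons {i j e e' e'' p h p' h'} : Step i e e' p h → e⁻¹ * h * e' ∉ A → i ≠ j →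
      ReducedPath A Step j e' e'' p' h' → ReducedPath A Step i e e'' (p * p') (h * h')

variable {M : ι → Subgroup G} {A : Subgroup G} {Step : ι → G → G → P → G → Prop}

theorem ReducedPath.notMem (hM : IsAmalgam M A)
    (mem : ∀ {i e e' p h}, Step i e e' p h → e⁻¹ * h * e' ∈ M i) {i e e' p h}
    (hr : ReducedPath A Step i e e' p h) : e⁻¹ * h * e' ∉ A := by
  suffices ∃ (g : G) (l : List (ι × G)), ((i, g) :: l).IsChain (fun x y => x.1 ≠ y.1) ∧
      (∀ x ∈ (i, g) :: l, x.2 ∈ M x.1 ∧ x.2 ∉ A) ∧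
      (((i, g) :: l).map Prod.snd).prod = e⁻¹ * h * e' by
    obtain ⟨g, l, h₁, h₂, h₃⟩ := this
    exact h₃ ▸ hM.prod_notMem _ (by simp) h₁ h₂
  induction hr with
  | single hs hA => exact ⟨_, [], by simp, by simpa using ⟨mem hs, hA⟩, by simp⟩
  | @cons i j e e' e'' p h p' h' hs hA hij _ ih =>
    obtain ⟨g, l, h₁, h₂, h₃⟩ := ih
    refine ⟨e⁻¹ * h * e', (j, g) :: l, List.isChain_cons_cons.2 ⟨hij, h₁⟩, ?_, ?_⟩
    · rintro x (_ | ⟨_, hx⟩)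
      · exact ⟨mem hs, hA⟩
      · exact h₂ x hx
    · rw [List.map_cons, List.prod_cons, h₃]
      group

theorem ReducedPath.base_mul
    (comp : ∀ {i e e' e'' p h p' h'}, Step i e e' p h → Step i e' e'' p' h' →
      Step i e e'' (p * p') (h * h'))
    (base : ∀ {i e e' p h}, Step i e e' p h → e⁻¹ * h * e' ∈ A → e = e' ∧ ∀ j, Step j e e' p h)
    {i j e e' e'' p h p' h'} (hs : Step i e e' p h) (hA : e⁻¹ * h * e' ∈ A)
    (hr : ReducedPath A Step j e' e'' p' h') :
    ReducedPath A Step j e e'' (p * p') (h * h') := by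
  have key : ∀ {f k}, e'⁻¹ * k * f ∉ A → e⁻¹ * (h * k) * f ∉ A := fun {f k} hk hk' => hk <| by
    have := A.mul_mem (A.inv_mem hA) hk'
    convert this using 1
    group
  cases hr with
  | single hs' hA' => exact .single (comp ((base hs hA).2 j) hs') (key hA')
  | cons hs' hA' hij hr =>
    rw [← mul_assoc, ← mul_assoc]
    exact .cons (comp ((base hs hA).2 j) hs') (key hA') hij hr

/-- Simple connectivity: a path whose label in `G` is trivial has trivial label in `P`. -/
theorem StepPath.eq_one (hM : IsAmalgam M A)
    (comp : ∀ {i e e' e'' p h p' h'}, Step i e e' p h → Step i e' e'' p' h' →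
      Step i e e'' (p * p') (h * h'))
    (mem : ∀ {i e e' p h}, Step i e e' p h → e⁻¹ * h * e' ∈ M i)
    (base : ∀ {i e e' p h}, Step i e e' p h → e⁻¹ * h * e' ∈ A → e = e' ∧ ∀ j, Step j e e' p h)
    (one : ∀ {i e p}, Step i e e p 1 → p = 1)
    {e p} (hp : StepPath Step e e p 1) : p = 1 := by
  have nf : ∀ {e e' p h}, StepPath Step e e' p h → (e = e' ∧ p = 1 ∧ h = 1) ∨
      (∃ i, Step i e e' p h ∧ e⁻¹ * h * e' ∈ A) ∨ ∃ i, ReducedPath A Step i e e' p h := by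
    intro e e' p h hp
    have step : ∀ {i e e' p h}, Step i e e' p h →
        (∃ i, Step i e e' p h ∧ e⁻¹ * h * e' ∈ A) ∨ ∃ i, ReducedPath A Step i e e' p h := by
      intro i e e' p h hs
      by_cases hA : e⁻¹ * h * e' ∈ A
      · exact .inl ⟨i, hs, hA⟩
      · exact .inr ⟨i, .single hs hA⟩
    induction hp with
    | nil => simp
    | @cons i e e' e'' p h p' h' hs _ ih =>
      right
      obtain ⟨rfl, rfl, rfl⟩ | ⟨j, hs', hA'⟩ | ⟨j, hr⟩ := ih
      · simpa using step hs
      · obtain ⟨rfl, hj⟩ := base hs' hA'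
        exact step (comp hs (hj i))
      by_cases hA : e⁻¹ * h * e' ∈ A
      · exact .inr ⟨j, ReducedPath.base_mul (Step := Step) comp base hs hA hr⟩
      by_cases hij : i = j
      · subst hij
        cases hr with
        | single hs' _ => exact step (comp hs hs')
        | @cons _ _ _ f _ _ k _ _ hs' hA' hij hr =>
          rw [← mul_assoc, ← mul_assoc]
          have hc := comp hs hs'
          by_cases hA'' : e⁻¹ * (h * k) * f ∈ A
          · exact .inr ⟨_, ReducedPath.base_mul (Step := Step) comp base hc hA'' hr⟩
          · exact .inr ⟨_, .cons hc hA'' hij hr⟩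
      · exact .inr ⟨_, .cons hs hA hij hr⟩
  obtain ⟨-, rfl, -⟩ | ⟨i, hs, -⟩ | ⟨i, hr⟩ := nf hp
  · rfl
  · exact one hs
  · exact absurd (by simp [A.one_mem]) (hr.notMem hM mem)

end Paths

theorem exists_doubleCosetRep {G : Type*} [Group G] (H K : Subgroup G) :
    ∃ r : G → G, (∀ x, ∃ h ∈ H, (r x)⁻¹ * h * x ∈ K) ∧
      ∀ x y, ∀ h ∈ H, x⁻¹ * h * y ∈ K → r x = r y := by
  refine ⟨fun x => (DoubleCoset.mk H K x).out, fun x => ?_, fun x y h hh hK => ?_⟩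
  · obtain ⟨h, k, hh, hk, hx⟩ := DoubleCoset.mk_out_eq_mul H K x
    refine ⟨h, hh, ?_⟩
    simp only [hx]
    simpa [mul_assoc] using hk
  · refine congrArg Quotient.out ((DoubleCoset.eq H K x y).2
      ⟨h⁻¹, H.inv_mem hh, x⁻¹ * h * y, hK, by group⟩)

/-- Every element of a finitely generated subgroup `H` is read along a closed path all of whose
steps belong to a fixed finite set. -/
theorem exists_finite_steps {ι G : Type*} [Group G] [Nonempty ι] {M : ι → Subgroup G}
    {A : Subgroup G} (hM : IsAmalgam M A) {H : Subgroup G} (hH : H.FG) {r : G → G}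
    (hr₁ : ∀ x, ∃ h ∈ H, (r x)⁻¹ * h * x ∈ A)
    (hr₂ : ∀ x y, ∀ h ∈ H, x⁻¹ * h * y ∈ A → r x = r y) :
    ∃ S : Set (ι × G × G × G), S.Finite ∧
      (∀ i e e' h, (i, e, e', h) ∈ S → h ∈ H ∧ e⁻¹ * h * e' ∈ M i ∧ r e = e ∧ r e' = e') ∧
      ∀ h ∈ H, StepPath (fun i e e' (_ : Unit) h => (i, e, e', h) ∈ S) (r 1) (r 1) () h := by
  have hrr : ∀ x, r (r x) = r x := fun x => by
    obtain ⟨h, hh, hA⟩ := hr₁ x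
    exact hr₂ _ _ h hh hA
  let Step : ι → G → G → Unit → G → Prop := fun i e e' _ h =>
    h ∈ H ∧ e⁻¹ * h * e' ∈ M i ∧ r e = e ∧ r e' = e'
  have path : ∀ g : G, ∀ e e' h, h ∈ H → r e = e → r e' = e' →
      ∀ a ∈ A, ∀ a' ∈ A, e⁻¹ * h * e' = a * g * a' → StepPath Step e e' () h := by
    intro g
    have hg : g ∈ ⨆ i, M i := hM.iSup_eq_top ▸ Subgroup.mem_top g
    have one_step : ∀ i, ∀ g ∈ M i, ∀ e e' h, h ∈ H → r e = e → r e' = e' →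
        ∀ a ∈ A, ∀ a' ∈ A, e⁻¹ * h * e' = a * g * a' → StepPath Step e e' () h := by
      intro i g hg e e' h hh he he' a ha a' ha' heq
      refine .single (i := i) ⟨hh, ?_, he, he'⟩
      rw [heq]
      exact mul_mem (mul_mem (hM.le i ha) hg) (hM.le i ha')
    induction hg using Subgroup.iSup_induction' with
    | hp i g hg => exact one_step i g hg
    | h1 => exact one_step (Classical.arbitrary ι) 1 (one_mem _)
    | hmul g₁ g₂ _ _ ih₁ ih₂ =>
      intro e e' h hh he he' a ha a' ha' heq
      obtain ⟨k, hk, hkA⟩ := hr₁ (e * a * g₁)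
      have h₁ := ih₁ e (r (e * a * g₁)) k⁻¹ (inv_mem hk) he (hrr _) a ha _ (inv_mem hkA)
        (by group)
      have h₂ := ih₂ (r (e * a * g₁)) e' (k * h) (mul_mem hk hh) (hrr _) he' _ hkA a' ha' (by
        have : h * e' = e * (a * (g₁ * g₂) * a') := by rw [← heq]; group
        rw [mul_assoc, mul_assoc k, this]
        group)
      simpa using h₁.append h₂
  have fin : ∀ {e e' u h}, StepPath Step e e' u h → ∃ S : Set (ι × G × G × G), S.Finite ∧
      (∀ i e e' h, (i, e, e', h) ∈ S → Step i e e' () h) ∧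
      StepPath (fun i e e' (_ : Unit) h => (i, e, e', h) ∈ S) e e' () h := by
    intro e e' u h hp
    induction hp with
    | nil e => exact ⟨∅, Set.finite_empty, by simp, .nil e⟩
    | @cons i e e' e'' p h p' h' hs _ ih =>
      obtain ⟨S, hS, hS', hp⟩ := ih
      refine ⟨insert (i, e, e', h) S, hS.insert _, ?_, .cons (p := ()) (.inl rfl)
        (hp.map (MonoidHom.id _) fun h => .inr h)⟩
      intro i e e' h hmem
      obtain heq | hmem := hmem
      · simp only [Prod.mk.injEq] at heq
        obtain ⟨rfl, rfl, rfl, rfl⟩ := heq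
        exact hs
      · exact hS' _ _ _ _ hmem
  obtain ⟨X, hXH, hX⟩ := (Submonoid.fg_iff _).1 ((Subgroup.fg_iff_submonoid_fg H).1 hH)
  have hXmem : ∀ x ∈ X, x ∈ H := fun x hx => by
    have : x ∈ H.toSubmonoid := hXH ▸ Submonoid.subset_closure hx
    exact this
  have hex : ∀ x : X, ∃ S : Set (ι × G × G × G), S.Finite ∧
      (∀ i e e' h, (i, e, e', h) ∈ S → Step i e e' () h) ∧
      StepPath (fun i e e' (_ : Unit) h => (i, e, e', h) ∈ S) (r 1) (r 1) () (x : G) := fun x =>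
    fin (path ((r 1)⁻¹ * x * r 1) _ _ _ (hXmem _ x.2) (hrr 1) (hrr 1) 1 (one_mem _) 1
      (one_mem _) (by group))
  choose S hS hS' hp using hex
  have := hX.to_subtype
  refine ⟨⋃ x, S x, Set.finite_iUnion hS, fun i e e' h hmem => ?_, fun h hh => ?_⟩
  · obtain ⟨x, hx⟩ := Set.mem_iUnion.1 hmem
    exact hS' x _ _ _ _ hx
  · have hh' : h ∈ Submonoid.closure X := hXH ▸ hh
    induction hh' using Submonoid.closure_induction with
    | mem x hx =>
      exact (hp ⟨x, hx⟩).map (MonoidHom.id _) fun h => Set.mem_iUnion.2 ⟨_, h⟩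
    | one => exact .nil _
    | mul x y hx hy ihx ihy =>
      have hcl : ∀ z ∈ Submonoid.closure X, z ∈ H := fun z hz => by
        have : z ∈ H.toSubmonoid := hXH ▸ hz
        exact this
      exact (ihx (hcl x hx)).append (ihy (hcl y hy))

/-- Finitely many finitely presented subgroups of a finitely generated group `H` lift
simultaneously to some finitely presented cover of `H`. -/
theorem exists_cover {G : Type*} [Group G] {H : Subgroup G} (hH : H.FG) {V : Type*} [Finite V]
    (K : V → Subgroup G) (hK : ∀ v, K v ≤ H) (hfp : ∀ v, Group.IsFinitelyPresented (K v)) :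
    ∃ (P : Type) (_ : Group P) (_ : Group.IsFinitelyPresented P) (π : P →* G)
      (σ : ∀ v, K v →* P), π.range = H ∧ ∀ v k, π (σ v k) = k := by
  obtain ⟨X, hXH, hX⟩ := (Subgroup.fg_iff H).1 hH
  have := hX.to_subtype
  obtain ⟨n, ⟨eX⟩⟩ := Finite.exists_equiv_fin X
  let ψ : FreeGroup (Fin n) →* G := FreeGroup.lift fun i => (eX.symm i : G)
  have hψ : ψ.range = H := by
    rw [FreeGroup.range_lift_eq_closure, ← hXH]
    congr 1
    ext x
    simp only [Set.mem_range]
    exact ⟨fun ⟨y, hy⟩ => hy ▸ (eX.symm y).2, fun hx => ⟨eX ⟨x, hx⟩, by simp⟩⟩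
  choose m φ hφ rels hrels hker using fun v => (hfp v).out
  have hlift : ∀ v (j : Fin (m v)), ∃ w, ψ w = φ v (FreeGroup.of j) := fun v j => by
    have : (φ v (FreeGroup.of j) : G) ∈ ψ.range := hψ ▸ hK v (φ v (FreeGroup.of j)).2
    exact this
  choose w hw using hlift
  let θ : ∀ v, FreeGroup (Fin (m v)) →* FreeGroup (Fin n) := fun v => FreeGroup.lift (w v)
  have hθ : ∀ v x, ψ (θ v x) = φ v x := fun v => by
    have : ψ.comp (θ v) = (K v).subtype.comp (φ v) := by
      ext j
      simpa [θ] using hw v j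
    exact DFunLike.congr_fun this
  let R : Set (FreeGroup (Fin n)) := ⋃ v, θ v '' rels v
  have hR : R.Finite := Set.finite_iUnion fun v => (hrels v).image _
  have hrel : ∀ v, ∀ x ∈ rels v, φ v x = 1 := fun v x hx => by
    rw [← MonoidHom.mem_ker, ← hker v]
    exact Subgroup.subset_normalClosure hx
  have := hR.to_subtype
  have hπ : ∀ x ∈ R, FreeGroup.lift (fun i => (eX.symm i : G)) x = 1 := by
    intro x hx
    obtain ⟨v, y, hy, rfl⟩ := Set.mem_iUnion.1 hx
    simpa [hrel v y hy] using hθ v y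
  have hσ : ∀ v, (φ v).ker ≤ ((PresentedGroup.mk R).comp (θ v)).ker := fun v => by
    rw [← hker v]
    refine Subgroup.normalClosure_le_normal fun x hx => ?_
    exact PresentedGroup.one_of_mem (Set.mem_iUnion.2 ⟨v, x, hx, rfl⟩)
  refine ⟨PresentedGroup R, inferInstance, inferInstance, PresentedGroup.toGroup hπ,
    fun v => MonoidHom.liftOfSurjective (φ v) (hφ v) ⟨(PresentedGroup.mk R).comp (θ v), hσ v⟩, ?_, ?_⟩
  · rw [← hψ]
    ext x
    constructor
    · rintro ⟨y, rfl⟩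
      obtain ⟨y, rfl⟩ := PresentedGroup.mk_surjective R y
      exact ⟨y, rfl⟩
    · rintro ⟨y, rfl⟩
      exact ⟨PresentedGroup.mk R y, rfl⟩
  · intro v k
    obtain ⟨x, rfl⟩ := hφ v k
    rw [MonoidHom.liftOfRightInverse_comp_apply]
    exact hθ v x

theorem Coherent.isFinitelyPresented_of_conj {G : Type*} [Group G] {M K : Subgroup G}
    (hM : Coherent M) (hK : K.FG) {x : G} (hx : ∀ k ∈ K, x⁻¹ * k * x ∈ M) :
    Group.IsFinitelyPresented K := by
  have hcoh : Coherent K := hM.of_injective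
    (((MulAut.conj x⁻¹).toMonoidHom.comp K.subtype).codRestrict M
      fun k => by simpa using hx k k.2)
    fun a b h => Subtype.ext ((MulAut.conj x⁻¹).injective (congrArg Subtype.val h))
  have := hcoh ⊤ (Group.fg_def.1 ((Group.fg_iff_subgroup_fg K).2 hK))
  exact Group.IsFinitelyPresented.equiv Subgroup.topEquiv

/-- **Karrass–Solitar.** An amalgam of coherent groups is coherent if all subgroups of the
amalgamated subgroup are finitely generated. -/
theorem Coherent.of_isAmalgam {ι G : Type*} [Group G] [Finite ι] [Nonempty ι]
    {M : ι → Subgroup G} {A : Subgroup G} (hM : IsAmalgam M A) (hA : ∀ B ≤ A, B.FG)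
    (hMc : ∀ i, Coherent (M i)) : Coherent G := by
  intro H hH
  obtain ⟨rA, hrA₁, hrA₂⟩ := exists_doubleCosetRep H A
  choose r hr₁ hr₂ using fun i => exists_doubleCosetRep H (M i)
  choose t htH htM using hr₁
  obtain ⟨S, hSfin, hS, hpath⟩ := exists_finite_steps hM hH hrA₁ hrA₂
  -- the finite set of edges
  let W : Set G := (fun s => s.2.1) '' S ∪ (fun s => s.2.2.1) '' S
  have hWfin : W.Finite := (hSfin.image _).union (hSfin.image _)
  have hW : ∀ e ∈ W, rA e = e := by
    rintro _ (⟨⟨i, e, e', h⟩, hs, rfl⟩ | ⟨⟨i, e, e', h⟩, hs, rfl⟩)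
    · exact (hS i e e' h hs).2.2.1
    · exact (hS i e e' h hs).2.2.2
  have := hWfin.to_subtype
  -- the edge groups
  let D : G → Subgroup G := fun e => H ⊓ A.comap (MulAut.conj e⁻¹).toMonoidHom
  have hD : ∀ {e x}, x ∈ D e ↔ x ∈ H ∧ e⁻¹ * x * e ∈ A := fun {e x} => by
    simp [D, Subgroup.mem_inf]
  have hDfg : ∀ e, (D e).FG := fun e => by
    have h : ((D e).map (MulAut.conj e⁻¹).toMonoidHom).FG := hA _ <| by
      rintro _ ⟨x, hx, rfl⟩
      exact hx.2
    have h' := h.map' (MulAut.conj e).toMonoidHom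
    rw [Subgroup.map_map] at h'
    convert h'
    ext x
    simp [mul_assoc]
  -- the vertex groups
  let C : ι → G → Set G := fun i ρ =>
    {x | ∃ s ∈ S, s.1 = i ∧ r i s.2.1 = ρ ∧ x = t i s.2.1 * s.2.2.2 * (t i s.2.2.1)⁻¹}
  let K : ι → G → Subgroup G := fun i ρ =>
    (⨆ e ∈ {e ∈ W | r i e = ρ}, (D e).map (MulAut.conj (t i e)).toMonoidHom) ⊔
      Subgroup.closure (C i ρ)
  have hKfg : ∀ i ρ, (K i ρ).FG := fun i ρ => by
    refine .sup (.biSup (hWfin.subset (Set.sep_subset _ _)) _ fun e _ => (hDfg e).map' _)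
      ((Subgroup.fg_iff _).2 ⟨_, rfl, (hSfin.image fun s : ι × G × G × G =>
        t i s.2.1 * s.2.2.2 * (t i s.2.2.1)⁻¹).subset ?_⟩)
    rintro _ ⟨s, hs, -, -, rfl⟩
    exact ⟨s, hs, rfl⟩
  have hKD : ∀ i, ∀ e ∈ W, ∀ b ∈ D e, t i e * b * (t i e)⁻¹ ∈ K i (r i e) := fun i e he b hb =>
    Subgroup.mem_sup_left <| Subgroup.mem_iSup_of_mem e <| Subgroup.mem_iSup_of_mem ⟨he, rfl⟩
      ⟨b, hb, rfl⟩
  have hKS : ∀ i e e' h, (i, e, e', h) ∈ S → t i e * h * (t i e')⁻¹ ∈ K i (r i e) :=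
    fun i e e' h hs => Subgroup.mem_sup_right <| Subgroup.subset_closure ⟨_, hs, rfl, rfl, rfl⟩
  have hKle : ∀ i ρ, K i ρ ≤ H ⊓ (M i).comap (MulAut.conj ρ⁻¹).toMonoidHom := fun i ρ => by
    refine sup_le (iSup₂_le ?_) ((Subgroup.closure_le _).2 ?_)
    · rintro e ⟨-, rfl⟩ _ ⟨b, hb, rfl⟩
      obtain ⟨hbH, hbA⟩ := hD.1 hb
      refine ⟨H.mul_mem (H.mul_mem (htH i e) hbH) (H.inv_mem (htH i e)), ?_⟩
      have := mul_mem (mul_mem (htM i e) (hM.le i hbA)) (inv_mem (htM i e))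
      simpa [mul_assoc] using this
    · rintro _ ⟨⟨i, e, e', h⟩, hs, rfl, rfl, rfl⟩
      obtain ⟨hhH, hhM, -, -⟩ := hS i e e' h hs
      refine ⟨H.mul_mem (H.mul_mem (htH i e) hhH) (H.inv_mem (htH i e')), ?_⟩
      have := mul_mem (mul_mem (htM i e) hhM) (inv_mem (htM i e'))
      rw [← hr₂ i e e' h hhH hhM] at this
      simpa [mul_assoc] using this
  have hKH : ∀ {i ρ k}, k ∈ K i ρ → k ∈ H := fun hk => (hKle _ _ hk).1
  have hKM : ∀ {i ρ k}, k ∈ K i ρ → ρ⁻¹ * k * ρ ∈ M i := fun hk => by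
    simpa using (hKle _ _ hk).2
  -- a finitely presented cover of `H` to which the vertex groups lift
  let V : Set (ι × G) := (fun p => (p.1, r p.1 p.2)) '' (Set.univ ×ˢ W)
  have hVfin : V.Finite := (Set.finite_univ.prod hWfin).image _
  have := hVfin.to_subtype
  obtain ⟨P, _, _, π, σ₀, hπ, hσ₀⟩ := exists_cover hH (fun v : V => K v.1.1 v.1.2)
    (fun v k hk => hKH hk)
    fun v => (hMc v.1.1).isFinitelyPresented_of_conj (hKfg _ _) fun k hk => hKM hk
  have hσ : ∀ i ρ, ∃ σ : K i ρ →* P, (i, ρ) ∈ V → ∀ k, π (σ k) = k := fun i ρ => by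
    by_cases h : (i, ρ) ∈ V
    · exact ⟨σ₀ ⟨_, h⟩, fun _ => hσ₀ ⟨_, h⟩⟩
    · exact ⟨1, fun h' => absurd h' h⟩
  choose σ hσ using hσ
  replace hσ : ∀ i, ∀ e ∈ W, ∀ k, π (σ i (r i e) k) = k := fun i e he =>
    hσ i _ ⟨(i, e), ⟨Set.mem_univ _, he⟩, rfl⟩
  have hT : ∀ i e, ∃ T, π T = t i e := fun i e => by
    have : t i e ∈ π.range := hπ ▸ htH i e
    exact this
  choose T hT using hT
  let edge : ∀ i (e : W), D e →* P := fun i e =>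
    (MulAut.conj (T i e)⁻¹).toMonoidHom.comp ((σ i (r i e)).comp
      (((MulAut.conj (t i e)).toMonoidHom.comp (D e).subtype).codRestrict (K i (r i e))
        fun b => hKD i e e.2 b b.2))
  have edge_apply : ∀ i (e : W) (b : D e), edge i e b =
      (T i e)⁻¹ * σ i (r i e) ⟨t i e * b * (t i e)⁻¹, hKD i e e.2 b b.2⟩ * T i e :=
    fun i e b => by simp [edge]
  have hedge : ∀ i (e : W) (b : D e), π (edge i e b) = b := fun i e b => by
    rw [edge_apply, map_mul, map_mul, map_inv, hT, hσ i e e.2]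
    group
  let Step : ι → G → G → P → G → Prop := fun i e e' p h => e ∈ W ∧ e' ∈ W ∧
    ∃ ρ, r i e = ρ ∧ r i e' = ρ ∧ ∃ k : K i ρ, h = (t i e)⁻¹ * k * t i e' ∧
      p = (T i e)⁻¹ * σ i ρ k * T i e'
  have hStepπ : ∀ {i e e' p h}, Step i e e' p h → π p = h := by
    rintro i e e' _ _ ⟨he, -, _, rfl, -, k, rfl, rfl⟩
    simp [hT, hσ i e he]
  have hpathP : ∀ x, ∃ p, StepPath Step (rA 1) (rA 1) p (π x) := fun x => by
    have hx : π x ∈ H := hπ ▸ ⟨x, rfl⟩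
    refine (hpath _ hx).lift ?_
    intro i e e' _ h hs
    obtain ⟨hhH, hhM, -, -⟩ := hS i e e' h hs
    exact ⟨_, .inl ⟨_, hs, rfl⟩, .inr ⟨_, hs, rfl⟩, _, rfl, (hr₂ i e e' h hhH hhM).symm,
      ⟨_, hKS i e e' h hs⟩, by group, rfl⟩
  choose q hq using hpathP
  -- the remaining finitely many relators
  have : Group.FG P := by
    obtain ⟨n, φ, hφ, -⟩ := Group.IsFinitelyPresented.out (G := P)
    exact Group.fg_of_surjective hφ
  obtain ⟨X, hXtop, hXfin⟩ := (Submonoid.fg_iff _).1 (Monoid.fg_def.1 (Group.fg_iff_monoid_fg.1 this))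
  choose Y hYtop hYfin using fun e => Group.fg_iff.1 ((Group.fg_iff_subgroup_fg (D e)).2 (hDfg e))
  let Q : Set P := (⋃ i, ⋃ j, ⋃ e : W, (fun b => edge i e b * (edge j e b)⁻¹) '' Y e) ∪
    (fun x => x * (q x)⁻¹) '' X
  have hQfin : Q.Finite := .union (Set.finite_iUnion fun i => Set.finite_iUnion fun j =>
    Set.finite_iUnion fun e => (hYfin e).image _) (hXfin.image _)
  let f := QuotientGroup.mk' (Subgroup.normalClosure Q)
  have hfQ : ∀ x y, x * y⁻¹ ∈ Q → f x = f y := fun x y h => by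
    rw [← mul_inv_eq_one, ← map_inv, ← map_mul, ← MonoidHom.mem_ker, QuotientGroup.ker_mk']
    exact Subgroup.subset_normalClosure h
  have hfedge : ∀ i j (e : W) b, f (edge i e b) = f (edge j e b) := fun i j e => by
    refine DFunLike.congr_fun (MonoidHom.eq_of_eqOn_dense (f := f.comp (edge i e))
      (g := f.comp (edge j e)) (hYtop e) fun b hb => hfQ _ _ (.inl ?_))
    simp only [Set.mem_iUnion]
    exact ⟨i, j, e, b, hb, rfl⟩
  let Step' : ι → G → G → (P ⧸ Subgroup.normalClosure Q) → G → Prop := fun i e e' p h =>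
    ∃ p₀, f p₀ = p ∧ Step i e e' p₀ h
  have sc : ∀ {e p}, StepPath Step' e e p 1 → p = 1 := by
    refine StepPath.eq_one hM ?_ ?_ ?_ ?_
    · rintro i e e' e'' _ _ _ _ ⟨_, rfl, he, he', _, rfl, hρ, k, rfl, rfl⟩
        ⟨_, rfl, -, he'', ρ, hρ', hρ'', k', rfl, rfl⟩
      obtain rfl : r i e = ρ := hρ.symm.trans hρ'
      refine ⟨_, map_mul _ _ _, he, he'', _, rfl, hρ'', k * k', ?_, ?_⟩
      · simp [mul_assoc]
      · simp [mul_assoc]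
    · rintro i e e' _ _ ⟨_, -, he, he', _, rfl, hρ, k, rfl, -⟩
      have h₁ := htM i e'
      rw [hρ] at h₁
      have := mul_mem (mul_mem (inv_mem (htM i e)) (hKM k.2)) h₁
      simpa [mul_assoc] using this
    · rintro i e e' _ _ ⟨_, rfl, he, he', _, rfl, -, k, rfl, rfl⟩ hAmem
      have hh : (t i e)⁻¹ * k * t i e' ∈ H :=
        mul_mem (mul_mem (inv_mem (htH i e)) (hKH k.2)) (htH i e')
      obtain rfl : e = e' := by
        rw [← hW e he, ← hW e' he']
        exact hrA₂ _ _ _ hh hAmem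
      let b : D e := ⟨(t i e)⁻¹ * k * t i e, hD.2 ⟨hh, hAmem⟩⟩
      refine ⟨rfl, fun j => ⟨edge j ⟨e, he⟩ b, ?_, he, he, _, rfl, rfl,
        ⟨_, hKD j e he b b.2⟩, by simp [b, mul_assoc], edge_apply j ⟨e, he⟩ b⟩⟩
      rw [hfedge j i, edge_apply]
      congr 4
      ext
      simp [b, mul_assoc]
    · rintro i e _ ⟨_, rfl, he, -, _, rfl, -, k, hk, rfl⟩
      obtain rfl : k = 1 := by
        ext
        have h := hk.symm
        rw [mul_assoc, inv_mul_eq_one] at h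
        simpa using h.symm
      simp
  have lift_path : ∀ p, ∃ p₁, StepPath Step (rA 1) (rA 1) p₁ (π p) ∧ f p₁ = f p := fun p => by
    have hp : p ∈ Submonoid.closure X := hXtop ▸ Submonoid.mem_top p
    induction hp using Submonoid.closure_induction with
    | mem x hx => exact ⟨q x, hq x, (hfQ _ _ (.inr ⟨x, hx, rfl⟩)).symm⟩
    | one => exact ⟨1, by simpa using StepPath.nil _, rfl⟩
    | mul x y _ _ ihx ihy =>
      obtain ⟨p₁, h₁, h₁'⟩ := ihx
      obtain ⟨p₂, h₂, h₂'⟩ := ihy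
      exact ⟨p₁ * p₂, by simpa using h₁.append h₂, by simp only [map_mul, h₁', h₂']⟩
  have hker : π.ker = Subgroup.normalClosure Q := by
    apply le_antisymm
    · intro p hp
      obtain ⟨p₁, h₁, h₁'⟩ := lift_path p
      rw [MonoidHom.mem_ker.1 hp] at h₁
      have h₂ : StepPath Step' (rA 1) (rA 1) (f p₁) 1 := h₁.map f fun hs => ⟨_, rfl, hs⟩
      rw [← QuotientGroup.ker_mk' (Subgroup.normalClosure Q), MonoidHom.mem_ker]
      exact h₁'.symm.trans (sc h₂)
    · refine Subgroup.normalClosure_le_normal ?_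
      rintro _ (hx | ⟨x, -, rfl⟩)
      · simp only [Set.mem_iUnion] at hx
        obtain ⟨i, j, e, b, -, rfl⟩ := hx
        simp [MonoidHom.mem_ker, hedge]
      · simp [MonoidHom.mem_ker, (hq x).map_eq π hStepπ]
  rw [← hπ]
  exact Group.IsFinitelyPresented.of_surjective π.rangeRestrict π.rangeRestrict_surjective
    ⟨Q, hQfin, by rw [MonoidHom.ker_rangeRestrict, hker]⟩

open Monoid in
theorem isAmalgam_pushoutI {ι B : Type*} [Nonempty ι] {G : ι → Type*} [∀ i, Group (G i)] [Group B]
    {φ : ∀ i, B →* G i} (hφ : ∀ i, Function.Injective (φ i)) :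
    IsAmalgam (fun i => (PushoutI.of i : G i →* PushoutI φ).range) (PushoutI.base φ).range where
  le i := by
    rintro _ ⟨b, rfl⟩
    exact ⟨φ i b, PushoutI.of_apply_eq_base φ i b⟩
  iSup_eq_top := by
    rw [eq_top_iff]
    rintro x -
    induction x using PushoutI.induction_on with
    | of i g => exact Subgroup.mem_iSup_of_mem i ⟨g, rfl⟩
    | base b =>
      obtain ⟨i⟩ := ‹Nonempty ι›
      exact Subgroup.mem_iSup_of_mem i ⟨φ i b, PushoutI.of_apply_eq_base φ i b⟩
    | mul x y hx hy => exact mul_mem hx hy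
  prod_notMem l hne hchain hl := by
    obtain ⟨l, rfl⟩ : ∃ l' : List (Σ i, G i), l'.map (fun x => (x.1, PushoutI.of x.1 x.2)) = l := by
      suffices l ∈ Set.range (List.map fun x : Σ i, G i => (x.1, (PushoutI.of x.1 x.2 : PushoutI φ)))
        from this
      rw [Set.range_list_map]
      rintro ⟨i, x⟩ hx
      obtain ⟨g, hg⟩ := (hl _ hx).1
      exact ⟨⟨i, g⟩, Prod.ext rfl hg⟩
    have hred : ∀ x ∈ l, x.2 ∉ (φ x.1).range := by
      rintro ⟨i, x⟩ hx ⟨b, hb⟩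
      refine (hl _ (List.mem_map_of_mem hx)).2 ⟨b, ?_⟩
      rw [← PushoutI.of_apply_eq_base φ i b, hb]
    let w : CoprodI.Word G :=
      ⟨l, fun x hx h => hred x hx (h ▸ one_mem _), by simpa [List.isChain_map] using hchain⟩
    intro h
    have := PushoutI.Reduced.eq_empty_of_mem_range hφ (w := w) hred <| by
      convert h using 1
      simp [w, CoprodI.Word.prod, Function.comp_def, map_list_prod]
    exact hne (by simpa [w] using congrArg CoprodI.Word.toList this)

open Monoid in
theorem Coherent.pushoutI {ι B : Type*} [Finite ι] [Nonempty ι] {G : ι → Type*}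
    [∀ i, Group (G i)] [Group B] {φ : ∀ i, B →* G i} (hφ : ∀ i, Function.Injective (φ i))
    (hG : ∀ i, Coherent (G i)) (hB : ∀ B' : Subgroup B, B'.FG) : Coherent (PushoutI φ) := by
  refine .of_isAmalgam (isAmalgam_pushoutI hφ) (fun A hA => ?_) fun i => ?_
  · rw [← Subgroup.map_comap_eq_self hA]
    exact (hB _).map' _
  · exact (hG i).of_injective (MonoidHom.ofInjective (PushoutI.of_injective hφ i)).symm.toMonoidHom
      (MulEquiv.injective _)

open Monoid in
/-- Free products of finitely many cyclic groups are coherent. -/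
theorem coherent_presentedGroup_of_pow {ι : Type*} [Finite ι] [Nonempty ι] (e : ι → ℕ) :
    Coherent (PresentedGroup {w : FreeGroup ι | ∃ i, w = FreeGroup.of i ^ e i}) := by
  let R := {w : FreeGroup ι | ∃ i, w = FreeGroup.of i ^ e i}
  let C : ι → Type _ := fun i => Subgroup.zpowers (PresentedGroup.of i : PresentedGroup R)
  let φ : ∀ i, Unit →* C i := fun _ => 1
  have hof : ∀ i, (PresentedGroup.of i : PresentedGroup R) ^ e i = 1 := fun i => by
    rw [PresentedGroup.of, ← map_pow]
    exact PresentedGroup.one_of_mem ⟨i, rfl⟩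
  let c : ∀ i, C i := fun i => ⟨PresentedGroup.of i, Subgroup.mem_zpowers _⟩
  let f : PresentedGroup R →* PushoutI φ :=
    PresentedGroup.toGroup (f := fun i => PushoutI.of i (c i)) <| by
      rintro _ ⟨i, rfl⟩
      have : c i ^ e i = 1 := Subtype.ext (hof i)
      rw [map_pow, FreeGroup.lift_apply_of, ← map_pow, this, map_one]
  let g : PushoutI φ →* PresentedGroup R :=
    PushoutI.lift (fun i => (Subgroup.zpowers (PresentedGroup.of i)).subtype) 1 fun i => by
      ext; rfl
  have hgf : g.comp f = MonoidHom.id _ := PresentedGroup.ext fun i => by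
    simp [f, g, c]
    rfl
  refine Coherent.of_injective (Coherent.pushoutI (φ := φ) (fun i => ?_) (fun i => ?_) fun B' => ?_)
    f (Function.LeftInverse.injective (g := g) (DFunLike.congr_fun hgf))
  · exact Function.injective_of_subsingleton _
  · exact Coherent.of_isCyclic (Subgroup.zpowers _)
  · exact (Group.fg_iff_subgroup_fg _).1 inferInstance

namespace FTypeBase

variable (D : FTypeBase)

theorem coherent_Gp1 (hn : 0 < D.n) : Coherent D.Gp1 := by
  have : Nonempty (Fin D.n) := ⟨⟨0, hn⟩⟩
  have h : D.rels1 =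
      {w | ∃ i, w = FreeGroup.of i ^ (fun i : Fin D.n => if (i : ℕ) < D.p then D.e i else 1) i} := by
    ext w
    constructor
    · rintro (⟨i, hi, rfl⟩ | ⟨i, hi, rfl⟩)
      · exact ⟨i, by simp [hi]⟩
      · exact ⟨i, by simp [hi.not_gt]⟩
    · rintro ⟨i, rfl⟩
      by_cases hi : (i : ℕ) < D.p
      · exact .inl ⟨i, hi, by simp [hi]⟩
      · exact .inr ⟨i, not_lt.1 hi, by simp [hi]⟩
  change Coherent (PresentedGroup D.rels1)
  rw [h]
  exact coherent_presentedGroup_of_pow _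

theorem coherent_Gp2 (hn : 0 < D.n) : Coherent D.Gp2 := by
  have : Nonempty (Fin D.n) := ⟨⟨0, hn⟩⟩
  have h : D.rels2 =
      {w | ∃ i, w = FreeGroup.of i ^ (fun i : Fin D.n => if (i : ℕ) < D.p then 1 else D.e i) i} := by
    ext w
    constructor
    · rintro (⟨i, hi, rfl⟩ | ⟨i, hi, rfl⟩)
      · exact ⟨i, by simp [hi.not_gt]⟩
      · exact ⟨i, by simp [hi]⟩
    · rintro ⟨i, rfl⟩
      by_cases hi : (i : ℕ) < D.p
      · exact .inr ⟨i, hi, by simp [hi]⟩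
      · exact .inl ⟨i, not_lt.1 hi, by simp [hi]⟩
  change Coherent (PresentedGroup D.rels2)
  rw [h]
  exact coherent_presentedGroup_of_pow _

end FTypeBase

/-- Two homomorphisms out of a free group agree on `w` if they agree on the letters of `w`. -/
theorem freeGroup_hom_eq_of_toWord {α G : Type*} [DecidableEq α] [Group G]
    {f g : FreeGroup α →* G} {w : FreeGroup α}
    (h : ∀ x ∈ w.toWord, f (FreeGroup.of x.1) = g (FreeGroup.of x.1)) : f w = g w := by
  suffices ∀ L : List (α × Bool), (∀ x ∈ L, f (FreeGroup.of x.1) = g (FreeGroup.of x.1)) →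
      f (FreeGroup.mk L) = g (FreeGroup.mk L) by
    simpa only [FreeGroup.mk_toWord] using this _ h
  intro L hL
  have hf : ∀ f : FreeGroup α →* G, f = FreeGroup.lift fun a => f (FreeGroup.of a) :=
    fun f => by ext; simp
  rw [hf f, hf g, FreeGroup.lift_mk, FreeGroup.lift_mk]
  exact congrArg List.prod (List.map_congr_left fun x hx => by rw [hL x hx])

open Monoid in
theorem FTypeBase.IsFType.coherent {D : FTypeBase} (hD : D.IsFType) : Coherent D.Gp := by
  obtain ⟨hn, -, -, -, hU, hV, -, -, hU', hV', -, -⟩ := hD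
  let G : Bool → Type := fun b => PresentedGroup (cond b D.rels1 D.rels2)
  let u : ∀ b, G b := fun b => match b with
    | true => D.imgU1
    | false => D.imgV2⁻¹
  let φ : ∀ b, Multiplicative ℤ →* G b := fun b => zpowersHom _ (u b)
  have hu : ∀ b, ¬ IsOfFinOrder (u b) := fun b => match b with
    | true => hU'
    | false => by simpa [u] using hV'
  have hφ : ∀ b, Function.Injective (φ b) := fun b x y h => by
    have := injective_zpow_iff_not_isOfFinOrder.2 (hu b)
    exact Multiplicative.toAdd.injective (this (by simpa [φ] using h))
  have hc : Coherent (PushoutI φ) := .pushoutI hφ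
    (fun b => match b with
      | true => D.coherent_Gp1 (by lia)
      | false => D.coherent_Gp2 (by lia))
    fun B => by
      obtain ⟨b, rfl⟩ := B.isCyclic_iff_exists_zpowers_eq_top.1 inferInstance
      exact (Subgroup.fg_iff _).2 ⟨{b}, (Subgroup.zpowers_eq_closure b).symm, Set.finite_singleton b⟩
  let o₁ : D.Gp1 →* PushoutI φ := PushoutI.of (G := G) true
  let o₂ : D.Gp2 →* PushoutI φ := PushoutI.of (G := G) false
  let x : Fin D.n → PushoutI φ := fun i =>
    if (i : ℕ) < D.p then o₁ (PresentedGroup.of i) else o₂ (PresentedGroup.of i)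
  have hxU : FreeGroup.lift x D.U = o₁ D.imgU1 := by
    refine freeGroup_hom_eq_of_toWord (g := o₁.comp (PresentedGroup.mk D.rels1)) fun y hy => ?_
    simp [x, hU y hy, PresentedGroup.of]
  have hxV : FreeGroup.lift x D.V = o₂ D.imgV2 := by
    refine freeGroup_hom_eq_of_toWord (g := o₂.comp (PresentedGroup.mk D.rels2)) fun y hy => ?_
    simp [x, (hV y hy).not_gt, PresentedGroup.of]
  have hUV : o₁ D.imgU1 = o₂ D.imgV2⁻¹ := by
    have h := fun b => PushoutI.of_apply_eq_base φ b (Multiplicative.ofAdd 1)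
    simpa [φ, u] using (h true).trans (h false).symm
  let f : D.Gp →* PushoutI φ := PresentedGroup.toGroup (f := x) <| by
    rintro _ (⟨i, rfl⟩ | rfl)
    · by_cases hi : (i : ℕ) < D.p
      · have : (PresentedGroup.of i : D.Gp1) ^ D.e i = 1 := by
          rw [PresentedGroup.of, ← map_pow]
          exact PresentedGroup.one_of_mem (.inl ⟨i, hi, rfl⟩)
        rw [map_pow, FreeGroup.lift_apply_of]
        simp only [x, hi, if_true]
        rw [← map_pow, this, map_one]
      · have : (PresentedGroup.of i : D.Gp2) ^ D.e i = 1 := by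
          rw [PresentedGroup.of, ← map_pow]
          exact PresentedGroup.one_of_mem (.inl ⟨i, not_lt.1 hi, rfl⟩)
        rw [map_pow, FreeGroup.lift_apply_of]
        simp only [x, hi, if_false]
        rw [← map_pow, this, map_one]
    · rw [map_mul, hxU, hxV, hUV, map_inv, inv_mul_cancel]
  have hpow : ∀ i, (PresentedGroup.of i : D.Gp) ^ D.e i = 1 := fun i => by
    rw [PresentedGroup.of, ← map_pow]
    exact PresentedGroup.one_of_mem (.inl ⟨i, rfl⟩)
  let g₁ : D.Gp1 →* D.Gp := PresentedGroup.toGroup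
    (f := fun i : Fin D.n => if (i : ℕ) < D.p then PresentedGroup.of i else 1) <| by
      rintro _ (⟨i, hi, rfl⟩ | ⟨i, hi, rfl⟩)
      · simp [hi, hpow]
      · simp [hi.not_gt]
  let g₂ : D.Gp2 →* D.Gp := PresentedGroup.toGroup
    (f := fun i : Fin D.n => if (i : ℕ) < D.p then 1 else PresentedGroup.of i) <| by
      rintro _ (⟨i, hi, rfl⟩ | ⟨i, hi, rfl⟩)
      · simp [hi.not_gt, hpow]
      · simp [hi]
  have hg₁ : g₁ D.imgU1 = PresentedGroup.mk D.rels D.U := by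
    refine freeGroup_hom_eq_of_toWord (f := g₁.comp (PresentedGroup.mk D.rels1)) fun y hy => ?_
    change g₁ (PresentedGroup.of y.1) = PresentedGroup.of y.1
    simp [g₁, hU y hy]
  have hg₂ : g₂ D.imgV2 = PresentedGroup.mk D.rels D.V := by
    refine freeGroup_hom_eq_of_toWord (f := g₂.comp (PresentedGroup.mk D.rels2)) fun y hy => ?_
    change g₂ (PresentedGroup.of y.1) = PresentedGroup.of y.1
    simp [g₂, (hV y hy).not_gt]
  have hg : g₁ D.imgU1 = g₂ D.imgV2⁻¹ := by
    rw [map_inv, hg₁, hg₂, ← mul_eq_one_iff_eq_inv, ← map_mul]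
    exact PresentedGroup.one_of_mem (.inr rfl)
  let g' : ∀ b, G b →* D.Gp := fun b => match b with
    | true => g₁
    | false => g₂
  let g : PushoutI φ →* D.Gp := PushoutI.lift g' (zpowersHom _ (g₁ D.imgU1)) fun b => by
    ext
    match b with
    | true => simp [φ, u, g']
    | false => simpa [φ, u, g'] using hg.symm
  have hgf : g.comp f = MonoidHom.id _ := PresentedGroup.ext fun i => by
    have h₁ : ∀ y, g (o₁ y) = g₁ y := fun y => PushoutI.lift_of (G := G) (i := true) ..
    have h₂ : ∀ y, g (o₂ y) = g₂ y := fun y => PushoutI.lift_of (G := G) (i := false) ..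
    by_cases hi : (i : ℕ) < D.p
    · simp [f, x, hi, h₁, g₁]
    · simp [f, x, hi, h₂, g₂]
  exact hc.of_injective f (Function.LeftInverse.injective (g := g) (DFunLike.congr_fun hgf))

/-- Every group of F-type is coherent: every finitely generated subgroup of a
group of F-type admits a finite presentation. -/
theorem fType_coherent (G : Type*) [Group G] (hG : IsFTypeGroup G)
    (H : Subgroup G) (hH : H.FG) : IsFinitelyPresented H := by
  obtain ⟨D, hD, ⟨φ⟩⟩ := hG
  have := hD.coherent.of_injective φ.toMonoidHom φ.injective H hH
  exact Group.IsFinitelyPresented.exists_mulEquiv_presentedGroup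

end FPaper
end

section
/- Let G be a group of F-type. Then G admits a representation ρ: G → PSL(2,ℂ) whose restrictions to the factor subgroups G_1 = ⟨a_1,…,a_p⟩ and G_2 = ⟨a_{p+1},…,a_n⟩ are faithful. Moreover, if neither U is a proper power in G_1 nor V is a proper power in G_2, then G admits a faithful representation into PSL(2,ℂ). -/
open scoped MatrixGroups

namespace FPaper

section Preparation

open Matrix Polynomial Monoid

section ProjectiveSpecialLinear

variable {K L : Type*} [Field K] [Field L]

/-- The projection from `SL(2, K)` to `PSL(2, K)`. -/
def toPSL : SL(2, K) →* PSL(2, K) := QuotientGroup.mk' _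

theorem toPSL_surjective : Function.Surjective (toPSL (K := K)) := QuotientGroup.mk'_surjective _

theorem toPSL_eq_one_iff (A : SL(2, K)) : toPSL A = 1 ↔ A = 1 ∨ A = -1 := by
  rw [toPSL, QuotientGroup.mk'_apply, QuotientGroup.eq_one_iff A,
    Matrix.SpecialLinearGroup.mem_center_iff]
  constructor
  · rintro ⟨r, hr, h⟩
    rw [Fintype.card_fin, sq_eq_one_iff] at hr
    rcases hr with rfl | rfl
    · left; ext i j; rw [← h]; simp
    · right; ext i j; rw [← h]; fin_cases i <;> fin_cases j <;> simp
  · rintro (rfl | rfl)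
    · exact ⟨1, by simp, by simp⟩
    · exact ⟨-1, by simp, by ext i j; fin_cases i <;> fin_cases j <;> simp⟩

theorem toPSL_eq_iff (A B : SL(2, K)) : toPSL A = toPSL B ↔ A = B ∨ A = -B := by
  rw [← mul_inv_eq_one, ← map_inv, ← map_mul, toPSL_eq_one_iff, mul_inv_eq_one,
    mul_inv_eq_iff_eq_mul]
  simp

/-- The homomorphism `PSL(2, K) → PSL(2, L)` induced by a field homomorphism. -/
def pslMap (f : K →+* L) : PSL(2, K) →* PSL(2, L) :=
  QuotientGroup.map _ _ (Matrix.SpecialLinearGroup.map f) fun A hA => by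
    have : toPSL A = 1 := (QuotientGroup.eq_one_iff A).2 hA
    refine (QuotientGroup.eq_one_iff (Matrix.SpecialLinearGroup.map f A)).1
      ((toPSL_eq_one_iff (Matrix.SpecialLinearGroup.map f A)).2 ?_)
    rcases (toPSL_eq_one_iff A).1 this with rfl | rfl
    · left; simp
    · right; ext i j; simp [Matrix.one_apply, apply_ite f]

theorem pslMap_toPSL (f : K →+* L) (A : SL(2, K)) :
    pslMap f (toPSL A) = toPSL (Matrix.SpecialLinearGroup.map f A) := rfl

theorem slMap_neg_one {R S : Type*} [CommRing R] [CommRing S] (f : R →+* S) :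
    Matrix.SpecialLinearGroup.map f (-1 : SL(2, R)) = -1 := by
  ext i j; simp [Matrix.one_apply, apply_ite f]

theorem slMap_neg {R S : Type*} [CommRing R] [CommRing S] (f : R →+* S) (A : SL(2, R)) :
    Matrix.SpecialLinearGroup.map f (-A) = -Matrix.SpecialLinearGroup.map f A := by
  ext i j; simp

theorem slMap_injective {R S : Type*} [CommRing R] [CommRing S] {f : R →+* S}
    (hf : Function.Injective f) :
    Function.Injective (Matrix.SpecialLinearGroup.map f : SL(2, R) →* SL(2, S)) := by
  intro A B h
  ext i j
  have := congrArg (fun M : SL(2, S) => M i j) h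
  exact hf (by simpa using this)

theorem pslMap_injective (f : K →+* L) : Function.Injective (pslMap f) := by
  rw [injective_iff_map_eq_one]
  intro a ha
  obtain ⟨A, rfl⟩ := toPSL_surjective a
  rw [pslMap_toPSL, toPSL_eq_one_iff] at ha
  rw [toPSL_eq_one_iff]
  refine ha.imp (fun h => ?_) (fun h => ?_)
  · exact slMap_injective f.injective (by simpa using h)
  · exact slMap_injective f.injective (by rw [h, slMap_neg_one])

/-- The diagonal matrix with entries `z` and `z⁻¹`. -/
def diagSL (z : Kˣ) : SL(2, K) := ⟨!![(z : K), 0; 0, ((z⁻¹ : Kˣ) : K)], by simp⟩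

theorem exists_conj_eq_diagSL (A : SL(2, K)) (z : Kˣ) (hz : (z : K) ^ 2 ≠ 1)
    (hA : A.1.trace = z + (z⁻¹ : Kˣ)) : ∃ Q : SL(2, K), Q * A * Q⁻¹ = diagSL z := by
  have hne : (z : K) ≠ (z⁻¹ : Kˣ) := by
    intro h
    apply hz
    rw [sq]
    nth_rewrite 2 [h]
    simp
  have hdet := A.2
  rw [Matrix.det_fin_two] at hdet
  rw [Matrix.trace_fin_two] at hA
  have hzz : (z : K) * (z⁻¹ : Kˣ) = 1 := by simp
  have key : ∀ r r' : K, r + r' = A.1 0 0 + A.1 1 1 → r * r' = 1 →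
      ∃ v : Fin 2 → K, v ≠ 0 ∧ A.1 *ᵥ v = r • v := by
    intro r r' h1 h2
    have : (A.1 - r • (1 : Matrix (Fin 2) (Fin 2) K)).det = 0 := by
      rw [Matrix.det_fin_two]
      simp
      linear_combination hdet - h2 + r * h1
    obtain ⟨v, hv, h⟩ := Matrix.exists_mulVec_eq_zero_iff.2 this
    refine ⟨v, hv, ?_⟩
    rw [Matrix.sub_mulVec, sub_eq_zero] at h
    simpa [Matrix.smul_mulVec] using h
  obtain ⟨v, hv, hAv⟩ := key z (z⁻¹ : Kˣ) hA.symm hzz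
  obtain ⟨w, hw, hAw⟩ := key (z⁻¹ : Kˣ) z (by rw [add_comm, hA]) (by simp)
  have v0 := congrFun hAv 0
  have v1 := congrFun hAv 1
  have w0 := congrFun hAw 0
  have w1 := congrFun hAw 1
  simp only [Matrix.mulVec, dotProduct, Fin.sum_univ_two, Pi.smul_apply, smul_eq_mul] at v0 v1 w0 w1
  have hd : v 0 * w 1 - v 1 * w 0 ≠ 0 := by
    intro h
    have e0 : ((z : K) - (z⁻¹ : Kˣ)) * (v 0 * w 0) = 0 := by
      linear_combination (-w 0) * v0 + v 0 * w0 - A.1 0 1 * h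
    have e1 : ((z : K) - (z⁻¹ : Kˣ)) * (v 1 * w 1) = 0 := by
      linear_combination (-w 1) * v1 + v 1 * w1 + A.1 1 0 * h
    have h0 : v 0 * w 0 = 0 := (mul_eq_zero.1 e0).resolve_left (sub_ne_zero.2 hne)
    have h1 : v 1 * w 1 = 0 := (mul_eq_zero.1 e1).resolve_left (sub_ne_zero.2 hne)
    by_cases hv0 : v 0 = 0
    · have hv1 : v 1 ≠ 0 := fun h' => hv (by ext i; fin_cases i <;> simp [hv0, h'])
      exact hw (by ext i; fin_cases i <;> simp_all)
    · exact hw (by ext i; fin_cases i <;> simp_all)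
  set d := v 0 * w 1 - v 1 * w 0 with hdd
  let R : SL(2, K) := ⟨!![v 0 / d, w 0; v 1 / d, w 1], by
    rw [Matrix.det_fin_two_of]; field_simp; rw [hdd]; ring⟩
  refine ⟨R⁻¹, ?_⟩
  rw [inv_inv, mul_assoc, inv_mul_eq_iff_eq_mul]
  ext i j
  simp only [Matrix.SpecialLinearGroup.coe_mul, Matrix.mul_apply, Fin.sum_univ_two]
  fin_cases i <;> fin_cases j <;> simp [R, diagSL] <;> field_simp
  · linear_combination v0
  · linear_combination (z : K) * w0 + w 0 * hzz
  · linear_combination v1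
  · linear_combination (z : K) * w1 + w 1 * hzz

end ProjectiveSpecialLinear

section LeadingCoefficients

variable {F : Type*} [Field F]

/-- The entries of `P` have degree at most `n`, and `A` is the matrix of their coefficients of
degree `n`. -/
def Lead (n : ℕ) (A : Matrix (Fin 2) (Fin 2) F) (P : Matrix (Fin 2) (Fin 2) F[X]) : Prop :=
  ∀ i j, (P i j).natDegree ≤ n ∧ (P i j).coeff n = A i j

theorem Lead.mul {n m : ℕ} {A B : Matrix (Fin 2) (Fin 2) F} {P Q : Matrix (Fin 2) (Fin 2) F[X]}
    (hP : Lead n A P) (hQ : Lead m B Q) : Lead (n + m) (A * B) (P * Q) := by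
  intro i j
  simp only [Matrix.mul_apply, Fin.sum_univ_two]
  refine ⟨natDegree_add_le_of_degree_le ?_ ?_, ?_⟩
  · exact natDegree_mul_le_of_le (hP i 0).1 (hQ 0 j).1
  · exact natDegree_mul_le_of_le (hP i 1).1 (hQ 1 j).1
  · rw [coeff_add, coeff_mul_add_eq_of_natDegree_le (hP i 0).1 (hQ 0 j).1,
      coeff_mul_add_eq_of_natDegree_le (hP i 1).1 (hQ 1 j).1, (hP i 0).2, (hP i 1).2, (hQ 0 j).2,
      (hQ 1 j).2]

theorem Lead.neg {n : ℕ} {A : Matrix (Fin 2) (Fin 2) F} {P : Matrix (Fin 2) (Fin 2) F[X]}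
    (hP : Lead n A P) : Lead n (-A) (-P) := fun i j => by
  simpa using hP i j

/-- The rank one matrix with column space spanned by `(1, s)` and row space by `(-t, 1)`. -/
def dir (s t : F) : Matrix (Fin 2) (Fin 2) F := !![-t, 1; -(s * t), s]

theorem dir_mul_dir (s t s' t' : F) : dir s t * dir s' t' = (s' - t) • dir s t' := by
  ext i j
  fin_cases i <;> fin_cases j <;> simp [dir] <;> ring

/-- The matrix with eigenvalues `a`, `b` whose eigenlines are spanned by `(1, s)` and
`(X, s X - 1)`. -/
noncomputable def elemMat (s a b : F) : Matrix (Fin 2) (Fin 2) F[X] :=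
  !![C b + C (a - b) * (1 - C s * X), C (a - b) * X;
    C (a - b) * (C s - C s ^ 2 * X), C b + C (a - b) * (C s * X)]

theorem elemMat_mul (s a b a' b' : F) :
    elemMat s a b * elemMat s a' b' = elemMat s (a * a') (b * b') := by
  ext1 i j
  fin_cases i <;> fin_cases j <;> simp [elemMat] <;> ring

/-- The one-parameter subgroup of the matrices `elemMat s z z⁻¹`. -/
noncomputable def elemSL (s : F) : Fˣ →* SL(2, F[X]) where
  toFun z := ⟨elemMat s z (z⁻¹ : Fˣ), by
    have h : (C z.1 : F[X]) * C (z⁻¹ : Fˣ).1 = 1 := by rw [← C_mul]; simp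
    rw [elemMat, Matrix.det_fin_two_of, C_sub]
    linear_combination h⟩
  map_one' := by
    ext1 i j
    fin_cases i <;> fin_cases j <;> simp [elemMat]
  map_mul' z w := by
    apply Subtype.ext
    have h : elemMat s (z * w : Fˣ) ((z * w)⁻¹ : Fˣ) =
        elemMat s z (z⁻¹ : Fˣ) * elemMat s w (w⁻¹ : Fˣ) := by
      rw [mul_inv, Units.val_mul, Units.val_mul, elemMat_mul]
    exact h

theorem elemSL_coe (s : F) (z : Fˣ) : (elemSL s z).1 = elemMat s z (z⁻¹ : Fˣ) := rfl

theorem elemSL_trace (s : F) (z : Fˣ) :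
    (elemSL s z).1.trace = C (z.1 + (z⁻¹ : Fˣ).1) := by
  rw [Matrix.trace_fin_two, elemSL_coe]
  generalize ((z⁻¹ : Fˣ) : F) = b
  simp [elemMat]
  ring

theorem lead_elemSL (s : F) (z : Fˣ) :
    Lead 1 ((z.1 - (z⁻¹ : Fˣ).1) • dir s s) (elemSL s z).1 := by
  have key : ∀ a b : F, ∀ P : F[X], P = C a * X + C b → P.natDegree ≤ 1 ∧ P.coeff 1 = a := by
    rintro a b P rfl
    exact ⟨natDegree_linear_le, by simp⟩
  rw [elemSL_coe]
  generalize ((z⁻¹ : Fˣ) : F) = b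
  intro i j
  fin_cases i <;> fin_cases j
  · refine key _ z.1 _ ?_
    simp [elemMat, dir]; ring
  · refine key _ 0 _ ?_
    simp [elemMat, dir]
  · refine key _ ((z.1 - b) * s) _ ?_
    simp [elemMat, dir]; ring
  · refine key _ b _ ?_
    simp [elemMat, dir]; ring

theorem Lead.eq_of_smul_dir {n m : ℕ} {c d s t s' t' : F} {P : Matrix (Fin 2) (Fin 2) F[X]}
    (hc : c ≠ 0) (hd : d ≠ 0) (h : Lead n (c • dir s t) P) (h' : Lead m (d • dir s' t') P) :
    s = s' ∧ t = t' ∧ n = m := by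
  have e1 : (P 0 1).coeff n = c := by rw [(h 0 1).2]; simp [dir]
  have e2 : (P 0 1).coeff m = d := by rw [(h' 0 1).2]; simp [dir]
  have h1 : n ≤ m := (le_natDegree_of_ne_zero (by rwa [e1])).trans (h' 0 1).1
  have h2 : m ≤ n := (le_natDegree_of_ne_zero (by rwa [e2])).trans (h 0 1).1
  obtain rfl := le_antisymm h1 h2
  have hcd : c = d := e1.symm.trans e2
  subst hcd
  have e3 : c * s = c * s' := by
    have := (h 1 1).2.symm.trans (h' 1 1).2
    simpa [dir] using this
  have e4 : c * -t = c * -t' := by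
    have := (h 0 0).2.symm.trans (h' 0 0).2
    simpa [dir] using this
  exact ⟨mul_left_cancel₀ hc e3, neg_injective (mul_left_cancel₀ hc e4), rfl⟩

theorem Lead.zero_lt {n m : ℕ} {d s t : F} {P : Matrix (Fin 2) (Fin 2) F[X]}
    (hd : d ≠ 0) (h : Lead n 0 P) (h' : Lead m (d • dir s t) P) : m < n := by
  have e2 : (P 0 1).coeff m = d := by rw [(h' 0 1).2]; simp [dir]
  have h2 : m ≤ n := (le_natDegree_of_ne_zero (by rwa [e2])).trans (h 0 1).1
  refine lt_of_le_of_ne h2 ?_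
  rintro rfl
  exact hd (e2.symm.trans (h 0 1).2)

end LeadingCoefficients

section FreeProducts

variable {ι : Type*} {G : ι → Type*} [∀ i, Group (G i)]

theorem exists_neWord [DecidableEq ι] [∀ i, DecidableEq (G i)] {g : CoprodI G} (hg : g ≠ 1) :
    ∃ (i j : ι) (w : CoprodI.NeWord G i j), w.prod = g := by
  have h : (CoprodI.Word.equiv g).prod = g := CoprodI.Word.equiv.symm_apply_apply g
  obtain ⟨i, j, w, hw⟩ := CoprodI.NeWord.of_word (CoprodI.Word.equiv g) (by
    intro h'
    rw [h', CoprodI.Word.prod_empty] at h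
    exact hg h.symm)
  exact ⟨i, j, w, by rw [CoprodI.NeWord.prod, hw, h]⟩

theorem neWord_strip_head {i j : ι} (w : CoprodI.NeWord G i j) :
    (i = j ∧ w.toList.length = 1 ∧ ∃ h : G i, h ≠ 1 ∧ w.prod = CoprodI.of h) ∨
    ∃ (h : G i) (k : ι) (w' : CoprodI.NeWord G k j), h ≠ 1 ∧ k ≠ i ∧
      w.prod = CoprodI.of h * w'.prod ∧ w'.toList.length + 1 = w.toList.length := by
  induction w with
  | singleton x hx => exact Or.inl ⟨rfl, rfl, x, hx, by simp⟩
  | append w₁ hne w₂ ih₁ _ =>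
    right
    rcases ih₁ with ⟨rfl, hl, h, h1, hp⟩ | ⟨h, k, w', h1, hk, hp, hl⟩
    · refine ⟨h, _, w₂, h1, hne.symm, by rw [CoprodI.NeWord.append_prod, hp], ?_⟩
      simp [CoprodI.NeWord.toList]; omega
    · exact ⟨h, k, .append w' hne w₂, h1, hk, by simp [hp, mul_assoc],
        by simp [CoprodI.NeWord.toList]; omega⟩

theorem neWord_strip_last {i j : ι} (w : CoprodI.NeWord G i j) :
    (i = j ∧ w.toList.length = 1 ∧ ∃ h : G j, h ≠ 1 ∧ w.prod = CoprodI.of h) ∨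
    ∃ (h : G j) (k : ι) (w' : CoprodI.NeWord G i k), h ≠ 1 ∧ k ≠ j ∧
      w.prod = w'.prod * CoprodI.of h ∧ w'.toList.length + 1 = w.toList.length := by
  induction w with
  | singleton x hx => exact Or.inl ⟨rfl, rfl, x, hx, by simp⟩
  | append w₁ hne w₂ _ ih₂ =>
    right
    rcases ih₂ with ⟨rfl, hl, h, h1, hp⟩ | ⟨h, k, w', h1, hk, hp, hl⟩
    · refine ⟨h, _, w₁, h1, hne, by rw [CoprodI.NeWord.append_prod, hp], ?_⟩
      simp [CoprodI.NeWord.toList]; omega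
    · exact ⟨h, k, .append w₁ hne w', h1, hk, by simp [hp, mul_assoc],
        by simp [CoprodI.NeWord.toList]; omega⟩

/-- An element of a free product is cyclically reduced if it is a nontrivial element of a factor or
is given by a word whose first and last letters lie in different factors. -/
def IsCycReduced (g : CoprodI G) : Prop :=
  (∃ (i : ι) (h : G i), h ≠ 1 ∧ g = CoprodI.of h) ∨
    ∃ (i j : ι) (w : CoprodI.NeWord G i j), i ≠ j ∧ g = w.prod

theorem neWord_isConj_isCycReduced (n : ℕ) {i j : ι} (w : CoprodI.NeWord G i j)
    (hn : w.toList.length = n) : ∃ g, IsConj w.prod g ∧ IsCycReduced g := by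
  induction n using Nat.strong_induction_on generalizing i j with
  | _ n ih =>
    by_cases hij : i = j
    · subst hij
      rcases neWord_strip_head w with ⟨_, _, h, h1, hp⟩ | ⟨h, k, w', h1, hk, hp, hl⟩
      · exact ⟨_, IsConj.refl _, Or.inl ⟨i, h, h1, hp⟩⟩
      · rcases neWord_strip_last w' with ⟨hki, _⟩ | ⟨h', l, w'', h1', hl', hp', hl''⟩
        · exact absurd hki hk
        · have hc : IsConj w.prod (w''.prod * CoprodI.of (h' * h)) := by
            rw [isConj_iff]
            refine ⟨(CoprodI.of h)⁻¹, ?_⟩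
            rw [hp, hp', map_mul]
            group
          by_cases hh : h' * h = 1
          · rw [hh, map_one, mul_one] at hc
            obtain ⟨g, hg, hg'⟩ := ih _ (by omega) w'' rfl
            exact ⟨g, hc.trans hg, hg'⟩
          · refine ⟨_, hc, Or.inr ⟨k, i, .append w'' hl' (.singleton (h' * h) hh), hk, ?_⟩⟩
            simp
    · exact ⟨_, IsConj.refl _, Or.inr ⟨i, j, w, hij, rfl⟩⟩

theorem exists_isConj_isCycReduced [DecidableEq ι] [∀ i, DecidableEq (G i)] {g : CoprodI G}
    (hg : g ≠ 1) : ∃ g', IsConj g g' ∧ IsCycReduced g' := by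
  obtain ⟨i, j, w, rfl⟩ := exists_neWord hg
  exact neWord_isConj_isCycReduced _ w rfl

end FreeProducts

section ProperPowers

variable {G H : Type*} [Group G] [Group H]

theorem mem_zpowers_of_not_isProperPower {u g : G} (hu : u ≠ 1) (hp : ¬ IsProperPower u)
    (h : u ∈ Subgroup.zpowers g) : g ∈ Subgroup.zpowers u := by
  obtain ⟨k, rfl⟩ := Subgroup.mem_zpowers_iff.1 h
  have key : ∀ (a : G) (m : ℕ), g ^ k = a ^ m → m < 2 := fun a m hm => by
    by_contra hlt
    exact hp ⟨a, m, by omega, hm⟩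
  obtain ⟨m, rfl | rfl⟩ := k.eq_nat_or_neg
  · have := key g m (by simp)
    interval_cases m
    · simp at hu
    · simp
  · have := key g⁻¹ m (by simp)
    interval_cases m
    · simp at hu
    · simp

theorem isProperPower_map_iff (e : G ≃* H) (g : G) : IsProperPower (e g) ↔ IsProperPower g := by
  constructor
  · rintro ⟨h, k, hk, hg⟩
    exact ⟨e.symm h, k, hk, e.injective (by simp [hg])⟩
  · rintro ⟨h, k, hk, hg⟩
    exact ⟨e h, k, hk, by rw [hg, map_pow]⟩

theorem isProperPower_inv_iff (g : G) : IsProperPower g⁻¹ ↔ IsProperPower g := by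
  constructor
  · rintro ⟨h, k, hk, hg⟩
    exact ⟨h⁻¹, k, hk, by rw [inv_pow, ← hg, inv_inv]⟩
  · rintro ⟨h, k, hk, hg⟩
    exact ⟨h⁻¹, k, hk, by rw [inv_pow, hg]⟩

end ProperPowers

section GenericRepresentation

variable {F K ι : Type*} [Field F] [Field K] (s : ι → F) (ζ : ι → Fˣ) (ev : F[X] →+* K)

/-- The cyclic subgroup of `PSL(2, K)` generated by the class of `elemSL (s i) (ζ i)`. -/
noncomputable def Cyc (i : ι) : Subgroup PSL(2, K) :=
  Subgroup.zpowers (toPSL (Matrix.SpecialLinearGroup.map ev (elemSL (s i) (ζ i))))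

/-- The distinguished generator of `Cyc s ζ ev i`. -/
noncomputable def cycGen (i : ι) : Cyc s ζ ev i := ⟨_, Subgroup.mem_zpowers _⟩

theorem exists_zpow_cycGen {i : ι} (h : Cyc s ζ ev i) : ∃ k : ℤ, cycGen s ζ ev i ^ k = h := by
  obtain ⟨k, hk⟩ := Subgroup.mem_zpowers_iff.1 h.2
  exact ⟨k, Subtype.ext (by simpa [cycGen] using hk)⟩

theorem coe_cycGen_zpow (i : ι) (k : ℤ) : ((cycGen s ζ ev i ^ k : Cyc s ζ ev i) : PSL(2, K)) =
    toPSL (Matrix.SpecialLinearGroup.map ev (elemSL (s i) (ζ i ^ k))) := by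
  simp [cycGen]

theorem elemSL_neg_one (a : F) : elemSL a (-1) = -1 := by
  ext1 i j
  fin_cases i <;> fin_cases j <;> simp [elemSL_coe, elemMat]

theorem sub_inv_ne_zero {z : Fˣ} (h1 : z ≠ 1) (h2 : z ≠ -1) : z.1 - (z⁻¹ : Fˣ).1 ≠ 0 := by
  intro h
  have h3 : z = z⁻¹ := Units.ext (sub_eq_zero.1 h)
  have h4 : z.1 * z.1 = 1 := by
    nth_rewrite 2 [h3]
    simp
  rcases mul_self_eq_one_iff.1 h4 with h | h
  · exact h1 (Units.ext h)
  · exact h2 (Units.ext (by simpa using h))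

theorem cycGen_zpow_eq_one_iff (hev : Function.Injective ev) (i : ι) (k : ℤ) :
    cycGen s ζ ev i ^ k = 1 ↔ ζ i ^ k = 1 ∨ ζ i ^ k = -1 := by
  rw [← Subtype.coe_inj, coe_cycGen_zpow, OneMemClass.coe_one, toPSL_eq_one_iff]
  generalize ζ i ^ k = z
  constructor
  · intro h
    have key : (elemSL (s i) z = 1 ∨ elemSL (s i) z = -1) :=
      h.imp (fun h => slMap_injective hev (h.trans (map_one _).symm))
        (fun h => slMap_injective hev (h.trans (slMap_neg_one ev).symm))
    by_contra hz
    rw [not_or] at hz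
    refine sub_inv_ne_zero hz.1 hz.2 ?_
    have h01 := (lead_elemSL (s i) z 0 1).2
    rcases key with key | key <;> rw [key] at h01 <;> simpa [dir] using h01.symm
  · rintro (rfl | rfl)
    · left; simp
    · right; rw [elemSL_neg_one, slMap_neg_one]

/-- The homomorphism from the free product of the groups `Cyc s ζ ev i` to `PSL(2, K)` which is the
inclusion on each factor. -/
noncomputable def genRep : CoprodI (fun i => Cyc s ζ ev i) →* PSL(2, K) :=
  CoprodI.lift fun i => (Cyc s ζ ev i).subtype

@[simp] theorem genRep_of {i : ι} (h : Cyc s ζ ev i) : genRep s ζ ev (CoprodI.of h) = h := by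
  simp [genRep]

/-- The image of `g` lifts to a polynomial matrix with leading term a nonzero multiple of
`dir (s i) (s j)` in degree `n ≥ 1`. -/
def HasLead (g : CoprodI (fun i => Cyc s ζ ev i)) (i j : ι) (n : ℕ) : Prop :=
  ∃ (P : SL(2, F[X])) (c : F), 1 ≤ n ∧ c ≠ 0 ∧ Lead n (c • dir (s i) (s j)) P.1 ∧
    toPSL (Matrix.SpecialLinearGroup.map ev P) = genRep s ζ ev g

variable {s ζ ev}

theorem hasLead_of (hev : Function.Injective ev) {i : ι} {h : Cyc s ζ ev i} (h1 : h ≠ 1) :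
    HasLead s ζ ev (CoprodI.of h) i i 1 := by
  obtain ⟨k, rfl⟩ := exists_zpow_cycGen s ζ ev h
  rw [Ne, cycGen_zpow_eq_one_iff s ζ ev hev, not_or] at h1
  exact ⟨_, _, le_rfl, sub_inv_ne_zero h1.1 h1.2, lead_elemSL (s i) (ζ i ^ k),
    by rw [genRep_of, coe_cycGen_zpow]⟩

theorem HasLead.mul (hs : Function.Injective s) {g h : CoprodI (fun i => Cyc s ζ ev i)}
    {i j k l : ι} {n m : ℕ} (hg : HasLead s ζ ev g i j n) (hh : HasLead s ζ ev h k l m)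
    (hjk : j ≠ k) : HasLead s ζ ev (g * h) i l (n + m) := by
  obtain ⟨P, c, hn, hc, hP, hPg⟩ := hg
  obtain ⟨Q, d, hm, hd, hQ, hQh⟩ := hh
  refine ⟨P * Q, c * d * (s k - s j), by omega,
    mul_ne_zero (mul_ne_zero hc hd) (sub_ne_zero.2 fun h => hjk (hs h).symm), ?_,
    by rw [map_mul, map_mul, map_mul, hPg, hQh]⟩
  have := hP.mul hQ
  rwa [smul_mul_smul_comm, dir_mul_dir, smul_smul] at this

theorem lift_eq_or_eq_neg (hev : Function.Injective ev) {P Q : SL(2, F[X])}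
    (h : toPSL (Matrix.SpecialLinearGroup.map ev P) =
      toPSL (Matrix.SpecialLinearGroup.map ev Q)) : P = Q ∨ P = -Q := by
  rw [toPSL_eq_iff, ← slMap_neg] at h
  exact h.imp (fun h => slMap_injective hev h) (fun h => slMap_injective hev h)

theorem HasLead.eq (hev : Function.Injective ev) (hs : Function.Injective s)
    {g : CoprodI (fun i => Cyc s ζ ev i)} {i j k l : ι} {n m : ℕ}
    (h : HasLead s ζ ev g i j n) (h' : HasLead s ζ ev g k l m) : i = k ∧ j = l ∧ n = m := by
  obtain ⟨P, c, hn, hc, hP, hPg⟩ := h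
  obtain ⟨Q, d, hm, hd, hQ, hQg⟩ := h'
  obtain ⟨d', hd', hQ'⟩ : ∃ d' : F, d' ≠ 0 ∧ Lead m (d' • dir (s k) (s l)) P.1 := by
    rcases lift_eq_or_eq_neg hev (hPg.trans hQg.symm) with rfl | rfl
    · exact ⟨d, hd, hQ⟩
    · exact ⟨-d, neg_ne_zero.2 hd, by simpa using hQ.neg⟩
  obtain ⟨h1, h2, h3⟩ := hP.eq_of_smul_dir hc hd' hQ'
  exact ⟨hs h1, hs h2, h3⟩

theorem HasLead.lt_of_mul (hev : Function.Injective ev)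
    {g h : CoprodI (fun i => Cyc s ζ ev i)} {i j k a b : ι} {n m r : ℕ}
    (hg : HasLead s ζ ev g i j n) (hh : HasLead s ζ ev h j k m)
    (hgh : HasLead s ζ ev (g * h) a b r) : r < n + m := by
  obtain ⟨P, c, -, -, hP, hPg⟩ := hg
  obtain ⟨Q, d, -, -, hQ, hQg⟩ := hh
  obtain ⟨R, e, -, he, hR, hRg⟩ := hgh
  have h0 := hP.mul hQ
  rw [smul_mul_smul_comm, dir_mul_dir, sub_self, zero_smul, smul_zero] at h0
  have h1 : toPSL (Matrix.SpecialLinearGroup.map ev R) =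
      toPSL (Matrix.SpecialLinearGroup.map ev (P * Q)) := by
    rw [hRg, map_mul, map_mul, map_mul, hPg, hQg]
  rcases lift_eq_or_eq_neg hev h1 with rfl | rfl
  · exact Lead.zero_lt he h0 hR
  · exact Lead.zero_lt (neg_ne_zero.2 he) h0 (by simpa using hR.neg)

theorem not_hasLead_one (hev : Function.Injective ev) {i j : ι} {n : ℕ} :
    ¬ HasLead s ζ ev 1 i j n := by
  rintro ⟨P, c, hn, hc, hP, hPg⟩
  rw [map_one, toPSL_eq_one_iff] at hPg
  have hP1 : P = 1 ∨ P = -1 :=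
    hPg.imp (fun h => slMap_injective hev (h.trans (map_one _).symm))
        (fun h => slMap_injective hev (h.trans (slMap_neg_one ev).symm))
  have h01 := (hP 0 1).2
  rcases hP1 with rfl | rfl <;> simp [dir] at h01 <;> exact hc h01.symm

theorem exists_hasLead (hev : Function.Injective ev) (hs : Function.Injective s) {i j : ι}
    (w : CoprodI.NeWord (fun i => Cyc s ζ ev i) i j) : ∃ n, HasLead s ζ ev w.prod i j n := by
  induction w with
  | singleton x hx => exact ⟨1, by simpa using hasLead_of hev hx⟩
  | append w₁ hne w₂ ih₁ ih₂ =>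
    obtain ⟨n, hn⟩ := ih₁
    obtain ⟨m, hm⟩ := ih₂
    exact ⟨n + m, by simpa using hn.mul hs hm hne⟩

theorem exists_hasLead_of_ne_one (hev : Function.Injective ev) (hs : Function.Injective s)
    {g : CoprodI (fun i => Cyc s ζ ev i)} (hg : g ≠ 1) :
    ∃ (i j : ι) (n m : ℕ), HasLead s ζ ev g i j n ∧ HasLead s ζ ev g⁻¹ j i m := by
  classical
  obtain ⟨i, j, w, rfl⟩ := exists_neWord hg
  obtain ⟨n, hn⟩ := exists_hasLead hev hs w
  obtain ⟨m, hm⟩ := exists_hasLead hev hs w.inv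
  exact ⟨i, j, n, m, hn, by rwa [CoprodI.NeWord.inv_prod] at hm⟩

theorem genRep_injective (hev : Function.Injective ev) (hs : Function.Injective s) :
    Function.Injective (genRep s ζ ev) := by
  rw [injective_iff_map_eq_one]
  intro g hg
  by_contra hne
  obtain ⟨i, j, n, -, ⟨P, c, hn, hc, hP, hPg⟩, -⟩ := exists_hasLead_of_ne_one hev hs hne
  refine not_hasLead_one (ζ := ζ) hev ⟨P, c, hn, hc, hP, ?_⟩
  rw [hPg, hg, map_one]

/-- The trace dichotomy: up to conjugacy a nontrivial element is a power of a generator, or its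
trace is a nonconstant polynomial. -/
theorem exists_lift_trace (hev : Function.Injective ev) (hs : Function.Injective s)
    {g : CoprodI (fun i => Cyc s ζ ev i)} (hg : g ≠ 1) :
    ∃ M : SL(2, K), toPSL M = genRep s ζ ev g ∧
      ((∃ (i : ι) (k : ℤ), IsConj g (CoprodI.of (cycGen s ζ ev i ^ k)) ∧ ζ i ^ k ≠ 1 ∧
          ζ i ^ k ≠ -1 ∧ M.1.trace = ev (C ((ζ i ^ k : Fˣ).1 + ((ζ i ^ k)⁻¹ : Fˣ).1))) ∨
        ∃ p : F[X], 0 < p.natDegree ∧ M.1.trace = ev p) := by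
  classical
  obtain ⟨g', hconj, hred⟩ := exists_isConj_isCycReduced hg
  obtain ⟨c, hc⟩ := isConj_iff.1 hconj.symm
  obtain ⟨Q, hQ⟩ := toPSL_surjective (genRep s ζ ev c)
  have htrace : ∀ P : SL(2, F[X]), (Q * Matrix.SpecialLinearGroup.map ev P * Q⁻¹).1.trace =
      ev P.1.trace := by
    intro P
    rw [Matrix.SpecialLinearGroup.coe_mul, Matrix.trace_mul_comm,
      ← Matrix.SpecialLinearGroup.coe_mul, ← mul_assoc, inv_mul_cancel, one_mul]
    simp [Matrix.trace_fin_two]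
  have hrep : ∀ P : SL(2, F[X]), toPSL (Matrix.SpecialLinearGroup.map ev P) = genRep s ζ ev g' →
      toPSL (Q * Matrix.SpecialLinearGroup.map ev P * Q⁻¹) = genRep s ζ ev g := by
    intro P hP
    rw [map_mul, map_mul, map_inv, hQ, hP, ← hc, map_mul, map_mul, map_inv]
  rcases hred with ⟨i, h, h1, rfl⟩ | ⟨i, j, w, hij, rfl⟩
  · obtain ⟨k, rfl⟩ := exists_zpow_cycGen s ζ ev h
    rw [Ne, cycGen_zpow_eq_one_iff s ζ ev hev, not_or] at h1
    exact ⟨_, hrep (elemSL (s i) (ζ i ^ k)) (by rw [genRep_of, coe_cycGen_zpow]),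
      Or.inl ⟨i, k, hconj, h1.1, h1.2, by rw [htrace, elemSL_trace]⟩⟩
  · obtain ⟨n, P, c, hn, hc, hP, hPg⟩ := exists_hasLead hev hs w
    refine ⟨_, hrep P hPg, Or.inr ⟨P.1.trace, ?_, htrace P⟩⟩
    refine lt_of_lt_of_le hn (le_natDegree_of_ne_zero ?_)
    rw [Matrix.trace_fin_two, coeff_add, (hP 0 0).2, (hP 1 1).2]
    have : (c • dir (s i) (s j)) 0 0 + (c • dir (s i) (s j)) 1 1 = c * (s i - s j) := by
      simp [dir]; ring
    rw [this]
    exact mul_ne_zero hc (sub_ne_zero.2 fun h => hij (hs h))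

theorem trace_ne_two (hev : Function.Injective ev) (hs : Function.Injective s)
    {g : CoprodI (fun i => Cyc s ζ ev i)} (hg : g ≠ 1) {M : SL(2, K)}
    (hM : toPSL M = genRep s ζ ev g) : M.1.trace ≠ 2 := by
  obtain ⟨N, hN, hcase⟩ := exists_lift_trace hev hs hg
  intro h2
  have hN2 : ∃ ε : F, (ε = 1 ∨ ε = -1) ∧ N.1.trace = ev (C (2 * ε)) := by
    rcases (toPSL_eq_iff N M).1 (hN.trans hM.symm) with rfl | rfl
    · exact ⟨1, Or.inl rfl, by simp only [mul_one, map_ofNat, h2]⟩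
    · exact ⟨-1, Or.inr rfl, by simp only [mul_one, mul_neg, map_neg, map_ofNat, h2,
        Matrix.SpecialLinearGroup.coe_neg, Matrix.trace_neg]⟩
  obtain ⟨ε, hε, hN2⟩ := hN2
  rcases hcase with ⟨i, k, -, h1, h1', htr⟩ | ⟨p, hp, htr⟩
  · generalize ζ i ^ k = z at *
    have h3 := C_injective (hev (htr.symm.trans hN2))
    have h4 : z.1 * (z⁻¹ : Fˣ).1 = 1 := by simp
    have h5 : (z.1 - ε) ^ 2 = 0 := by
      have : ε * ε = 1 := by rcases hε with rfl | rfl <;> ring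
      linear_combination z.1 * h3 - h4 + this
    have h6 : z.1 = ε := sub_eq_zero.1 (pow_eq_zero_iff two_ne_zero |>.1 h5)
    rcases hε with rfl | rfl
    · exact h1 (Units.ext h6)
    · exact h1' (Units.ext (by simpa using h6))
  · have h3 := hev (htr.symm.trans hN2)
    rw [h3, natDegree_C] at hp
    exact hp.false

theorem mem_zpowers_of_commute_of_isCycReduced (hev : Function.Injective ev)
    (hs : Function.Injective s) {u g : CoprodI (fun i => Cyc s ζ ev i)} (hred : IsCycReduced u)
    (hp : ¬ IsProperPower u) (hcomm : g * u = u * g) : g ∈ Subgroup.zpowers u := by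
  classical
  by_cases hg : g = 1
  · rw [hg]; exact one_mem _
  rcases hred with ⟨i, h, h1, rfl⟩ | ⟨i, j, w, hij, rfl⟩
  · have hu := hasLead_of hev h1
    have hu1 : CoprodI.of (M := fun i => Cyc s ζ ev i) h ≠ 1 :=
      fun hh => h1 (CoprodI.of_injective (M := fun i => Cyc s ζ ev i) i
        (hh.trans (map_one _).symm))
    have key : ∀ {k l : ι} (w : CoprodI.NeWord (fun i => Cyc s ζ ev i) k l),
        w.prod * CoprodI.of (M := fun i => Cyc s ζ ev i) h =
          CoprodI.of (M := fun i => Cyc s ζ ev i) h * w.prod → k = i ∧ l = i := by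
      intro k l w hw
      obtain ⟨n, hn⟩ := exists_hasLead hev hs w
      by_cases hk : k = i <;> by_cases hl : l = i
      · exact ⟨hk, hl⟩
      · subst hk
        have e1 := hn.mul hs hu hl
        rw [hw] at e1
        have := hu.lt_of_mul hev hn e1
        omega
      · subst hl
        have e1 := hu.mul hs hn (Ne.symm hk)
        rw [← hw] at e1
        have := hn.lt_of_mul hev hu e1
        omega
      · have e1 := hn.mul hs hu hl
        rw [hw] at e1
        exact absurd (e1.eq hev hs (hu.mul hs hn (Ne.symm hk))).1 hk
    obtain ⟨k, l, w, rfl⟩ := exists_neWord hg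
    obtain ⟨rfl, rfl⟩ := key w hcomm
    rcases neWord_strip_head w with ⟨_, _, h', h1', hw⟩ | ⟨h', k, w', h1', hk, hw, -⟩
    · rw [hw]
      obtain ⟨a, rfl⟩ := exists_zpow_cycGen s ζ ev h
      obtain ⟨b, rfl⟩ := exists_zpow_cycGen s ζ ev h'
      have := mem_zpowers_of_not_isProperPower
        (g := CoprodI.of (M := fun i => Cyc s ζ ev i) (cycGen s ζ ev l)) hu1 hp
        ⟨a, by simp⟩
      rw [map_zpow _ _ b]
      exact zpow_mem this b
    · refine absurd (key w' ?_).1 hk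
      have hc : h' * h = h * h' := by
        obtain ⟨a, rfl⟩ := exists_zpow_cycGen s ζ ev h
        obtain ⟨b, rfl⟩ := exists_zpow_cycGen s ζ ev h'
        exact (Commute.zpow_zpow_self _ _ _).eq
      rw [hw] at hcomm
      refine mul_left_cancel (a := CoprodI.of (M := fun i => Cyc s ζ ev i) h') ?_
      rw [← mul_assoc, hcomm, ← mul_assoc, ← map_mul, ← hc, map_mul, mul_assoc]
  · obtain ⟨N, hu⟩ := exists_hasLead hev hs w
    set u := w.prod
    have hu1 : u ≠ 1 := fun hh => not_hasLead_one hev (hh ▸ hu)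
    have key : ∀ x, x ≠ 1 → x * u = u * x →
        (∃ n, HasLead s ζ ev x i j n) ∨ ∃ n, HasLead s ζ ev x⁻¹ i j n := by
      intro x hx hc
      obtain ⟨k, l, n, m, hn, hm⟩ := exists_hasLead_of_ne_one hev hs hx
      by_cases hl : l = i <;> by_cases hk : j = k
      · subst hl hk
        exact Or.inr ⟨m, hm⟩
      · subst hl
        have e1 := hu.mul hs hn hk
        rw [← hc] at e1
        have := hn.lt_of_mul hev hu e1
        omega
      · subst hk
        have e1 := hn.mul hs hu hl
        rw [hc] at e1
        have := hu.lt_of_mul hev hn e1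
        omega
      · have e1 := hn.mul hs hu hl
        rw [hc] at e1
        obtain ⟨rfl, rfl, -⟩ := e1.eq hev hs (hu.mul hs hn hk)
        exact Or.inl ⟨n, hn⟩
    have hex : ∃ n x, x * u = u * x ∧ HasLead s ζ ev x i j n := ⟨N, u, rfl, hu⟩
    obtain ⟨x₀, hc₀, hx₀⟩ := Nat.find_spec hex
    have hmin : ∀ {n x}, x * u = u * x → HasLead s ζ ev x i j n → Nat.find hex ≤ n :=
      fun hc hx => Nat.find_min' hex ⟨_, hc, hx⟩
    set n₀ := Nat.find hex
    have hpos : ∀ n x, x * u = u * x → HasLead s ζ ev x i j n → x ∈ Subgroup.zpowers x₀ := by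
      intro n
      induction n using Nat.strong_induction_on with
      | _ n ih =>
        intro x hc hx
        have hc' : Commute (x₀⁻¹ * x) u := Commute.mul_left (Commute.inv_left hc₀) hc
        by_cases h1 : x₀⁻¹ * x = 1
        · rw [inv_mul_eq_one.1 h1]
          exact Subgroup.mem_zpowers _
        rcases key _ h1 hc' with ⟨m, hm⟩ | ⟨m, hm⟩
        · have e := (hx₀.mul hs hm hij.symm)
          rw [mul_inv_cancel_left] at e
          have e' := (hx.eq hev hs e).2.2
          have hn₀ : 1 ≤ n₀ := hx₀.choose_spec.choose_spec.1
          have := ih m (by omega) _ hc' hm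
          have h2 := mul_mem (Subgroup.mem_zpowers x₀) this
          rwa [mul_inv_cancel_left] at h2
        · have e := (hx.mul hs hm hij.symm)
          rw [_root_.mul_inv_rev, inv_inv, mul_inv_cancel_left] at e
          have e' := (hx₀.eq hev hs e).2.2
          have hm1 : 1 ≤ m := hm.choose_spec.choose_spec.1
          have := hmin hc hx
          omega
    have hx₀u := mem_zpowers_of_not_isProperPower hu1 hp (hpos N u rfl hu)
    have hg₀ : g ∈ Subgroup.zpowers x₀ := by
      rcases key g hg hcomm with ⟨n, hn⟩ | ⟨n, hn⟩
      · exact hpos n g hcomm hn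
      · have := hpos n g⁻¹ (Commute.inv_left hcomm) hn
        rwa [inv_mem_iff] at this
    exact (Subgroup.zpowers_le.2 hx₀u) hg₀

theorem mem_zpowers_of_commute (hev : Function.Injective ev)
    (hs : Function.Injective s) {u g : CoprodI (fun i => Cyc s ζ ev i)} (hu : u ≠ 1)
    (hp : ¬ IsProperPower u) (hcomm : g * u = u * g) : g ∈ Subgroup.zpowers u := by
  classical
  obtain ⟨u', hconj, hred⟩ := exists_isConj_isCycReduced hu
  obtain ⟨c, rfl⟩ := isConj_iff.1 hconj
  have h := mem_zpowers_of_commute_of_isCycReduced hev hs (g := MulAut.conj c g) hred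
    (fun h => hp ((isProperPower_map_iff (MulAut.conj c) u).1 h)) (by
      rw [← MulAut.conj_apply c u, ← map_mul, ← map_mul, hcomm])
  obtain ⟨k, hk⟩ := Subgroup.mem_zpowers_iff.1 h
  rw [← MulAut.conj_apply c u, ← map_zpow] at hk
  exact ⟨k, (MulAut.conj c).injective hk⟩

end GenericRepresentation

section FreeProductOfCyclics

variable {ι : Type*}

/-- The free product of the cyclic groups of orders `f i` (infinite if `f i = 0`). -/
abbrev CyclicProd (f : ι → ℕ) := PresentedGroup {w : FreeGroup ι | ∃ i, w = FreeGroup.of i ^ f i}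

theorem cyclicProd_of_pow (f : ι → ℕ) (i : ι) :
    (PresentedGroup.of i : CyclicProd f) ^ f i = 1 :=
  PresentedGroup.one_of_mem (rels := {w : FreeGroup ι | ∃ i, w = FreeGroup.of i ^ f i})
    ⟨i, rfl⟩

variable {F K : Type*} [Field F] [Field K] {s : ι → F} {ζ : ι → Fˣ} {ev : F[X] →+* K}

theorem exists_cyclicProd_equiv (hev : Function.Injective ev) {f : ι → ℕ}
    (hf : ∀ i (k : ℤ), ζ i ^ k = 1 ∨ ζ i ^ k = -1 ↔ (f i : ℤ) ∣ k) :
    ∃ e : CyclicProd f ≃* CoprodI (fun i => Cyc s ζ ev i),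
      ∀ i, e (PresentedGroup.of i) =
        CoprodI.of (M := fun i => Cyc s ζ ev i) (cycGen s ζ ev i) := by
  classical
  have hpow : ∀ i (k : ℤ), cycGen s ζ ev i ^ k = 1 ↔ (f i : ℤ) ∣ k := fun i k =>
    (cycGen_zpow_eq_one_iff s ζ ev hev i k).trans (hf i k)
  have hord : ∀ i, orderOf (cycGen s ζ ev i) = f i := fun i => by
    refine Nat.dvd_antisymm ?_ ?_
    · refine orderOf_dvd_of_pow_eq_one ?_
      have := (hpow i (f i)).2 dvd_rfl
      rwa [zpow_natCast] at this
    · rw [← Int.natCast_dvd_natCast, ← hpow, zpow_natCast, pow_orderOf_eq_one]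
  let a : CyclicProd f →* CoprodI (fun i => Cyc s ζ ev i) :=
    PresentedGroup.toGroup (f := fun i => CoprodI.of (M := fun i => Cyc s ζ ev i) (cycGen s ζ ev i))
      (by
        rintro _ ⟨i, rfl⟩
        rw [map_pow, FreeGroup.lift_apply_of, ← map_pow, ← hord i, pow_orderOf_eq_one, map_one])
  have ha : ∀ i, a (PresentedGroup.of i) =
      CoprodI.of (M := fun i => Cyc s ζ ev i) (cycGen s ζ ev i) := fun i =>
    PresentedGroup.toGroup.of _
  have hgen : ∀ i (x : Cyc s ζ ev i), x ∈ Subgroup.zpowers (cycGen s ζ ev i) :=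
    fun i x => exists_zpow_cycGen s ζ ev x
  have hdvd : ∀ i, orderOf (PresentedGroup.of i : CyclicProd f) ∣ orderOf (cycGen s ζ ev i) :=
    fun i => by
      rw [hord]
      exact orderOf_dvd_of_pow_eq_one (cyclicProd_of_pow f i)
  let b : CoprodI (fun i => Cyc s ζ ev i) →* CyclicProd f :=
    CoprodI.lift fun i => monoidHomOfForallMemZpowers (hgen i) (hdvd i)
  have hb : ∀ i, b (CoprodI.of (M := fun i => Cyc s ζ ev i) (cycGen s ζ ev i)) =
      PresentedGroup.of i := fun i => by
    simp only [b, CoprodI.lift_of]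
    exact monoidHomOfForallMemZpowers_apply_gen _ _
  refine ⟨a.toMulEquiv b ?_ ?_, ha⟩
  · ext i
    simp [ha, hb]
  · refine CoprodI.ext_hom _ _ fun i => ?_
    ext x
    obtain ⟨k, rfl⟩ := exists_zpow_cycGen s ζ ev x
    simp [ha, hb]

end FreeProductOfCyclics

section Transcendence

universe u

open Cardinal

/-- An isomorphism of uncountable algebraically closed fields can be chosen to respect prescribed
embeddings of a countable domain. -/
theorem exists_ringEquiv_comp_eq {R K L : Type u} [CommRing R] [IsDomain R] [Field K] [Field L]
    [IsAlgClosed K] [IsAlgClosed L] (hR : #R ≤ ℵ₀) (hK : ℵ₀ < #K) (hKL : #K = #L)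
    (f : R →+* K) (g : R →+* L) (hf : Function.Injective f) (hg : Function.Injective g) :
    ∃ σ : K ≃+* L, ∀ r, σ (f r) = g r := by
  let := f.toAlgebra
  let := g.toAlgebra
  have : FaithfulSMul R K := (faithfulSMul_iff_algebraMap_injective R K).2 hf
  have : FaithfulSMul R L := (faithfulSMul_iff_algebraMap_injective R L).2 hg
  obtain ⟨s, hs⟩ := exists_isTranscendenceBasis R K
  obtain ⟨t, ht⟩ := exists_isTranscendenceBasis R L
  have hst : #s = #t := by
    rw [← IsAlgClosed.cardinal_eq_cardinal_transcendence_basis_of_aleph0_lt' _ hs hR hK,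
      ← IsAlgClosed.cardinal_eq_cardinal_transcendence_basis_of_aleph0_lt' _ ht hR (hKL ▸ hK), hKL]
  obtain ⟨e⟩ := Cardinal.eq.1 hst
  let := IsAlgClosed.isAlgClosure_of_transcendence_basis _ hs
  let := IsAlgClosed.isAlgClosure_of_transcendence_basis _ ht
  let a : Algebra.adjoin R (Set.range ((↑) : s → K)) ≃ₐ[R]
      Algebra.adjoin R (Set.range ((↑) : t → L)) :=
    (hs.1.aevalEquiv.symm.trans (MvPolynomial.renameEquiv R e)).trans ht.1.aevalEquiv
  refine ⟨IsAlgClosure.equivOfEquiv K L a.toRingEquiv, fun r => ?_⟩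
  have h := IsAlgClosure.equivOfEquiv_algebraMap K L a.toRingEquiv (algebraMap R _ r)
  have h' : a.toRingEquiv (algebraMap R _ r) = algebraMap R _ r := a.commutes r
  rw [h'] at h
  exact h

theorem exists_ringEquiv_map_eq {a b : ℂ} (ha : Transcendental ℚ a) (hb : Transcendental ℚ b) :
    ∃ σ : ℂ ≃+* ℂ, σ a = b := by
  obtain ⟨σ, hσ⟩ := exists_ringEquiv_comp_eq (R := ℚ[X]) (K := ℂ) (L := ℂ)
    (Polynomial.cardinalMk_le_max.trans (by simp))
    (by simp [Cardinal.mk_complex, aleph0_lt_continuum]) rfl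
    (aeval a).toRingHom (aeval b).toRingHom (transcendental_iff_injective.1 ha)
    (transcendental_iff_injective.1 hb)
  exact ⟨σ, by simpa using hσ X⟩

theorem exists_transcendental_of_countable (F : Subfield ℂ) (hF : #F ≤ ℵ₀) :
    ∃ x : ℂ, Transcendental F x := by
  by_contra! h
  have : Algebra.IsAlgebraic F ℂ := ⟨fun x => by simpa [Transcendental] using h x⟩
  have h1 := Algebra.IsAlgebraic.cardinalMk_le_max F ℂ
  rw [Cardinal.mk_complex, max_eq_right hF] at h1
  exact absurd h1 (not_le.2 aleph0_lt_continuum)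

theorem exists_transcendental_rat : ∃ x : ℂ, Transcendental ℚ x := by
  by_contra! h
  have : Algebra.IsAlgebraic ℚ ℂ := ⟨fun x => by simpa [Transcendental] using h x⟩
  have h1 := Algebra.IsAlgebraic.cardinalMk_le_max ℚ ℂ
  rw [Cardinal.mk_complex] at h1
  exact absurd h1 (not_le.2 (by simpa using aleph0_lt_continuum))

theorem exists_unit_add_inv_eq (t : ℂ) : ∃ z : ℂˣ, t = z + (z⁻¹ : ℂˣ) := by
  obtain ⟨z, hz⟩ := IsAlgClosed.exists_root (X ^ 2 - C t * X + 1 : ℂ[X]) (by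
    have : (X ^ 2 - C t * X + 1 : ℂ[X]).degree = 2 := by compute_degree!
    rw [this]; norm_num)
  have h : z ^ 2 - t * z + 1 = 0 := by simpa using hz
  have h0 : z ≠ 0 := by
    rintro rfl
    simp at h
  refine ⟨Units.mk0 z h0, ?_⟩
  simp only [Units.val_mk0, Units.val_inv_eq_inv_val]
  field_simp
  linear_combination -h

theorem transcendental_of_add_inv {z : ℂˣ} (h : Transcendental ℚ ((z : ℂ) + (z⁻¹ : ℂˣ))) :
    Transcendental ℚ (z : ℂ) := fun hz => h (by
  rw [Units.val_inv_eq_inv_val]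
  exact hz.add hz.inv)

theorem transcendental_zpow {z : ℂˣ} (h : Transcendental ℚ (z : ℂ)) {k : ℤ} (hk : k ≠ 0) :
    Transcendental ℚ ((z ^ k : ℂˣ) : ℂ) := by
  intro hz
  rw [Units.val_zpow_eq_zpow_val] at hz
  obtain ⟨m, rfl | rfl⟩ := k.eq_nat_or_neg
  · rw [zpow_natCast] at hz
    exact h (hz.of_pow (by omega))
  · rw [_root_.zpow_neg, zpow_natCast, IsAlgebraic.inv_iff] at hz
    exact h (hz.of_pow (by omega))

/-- Over a field of constants, the values of nonconstant polynomials at a transcendental element are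
transcendental over the rationals. -/
theorem transcendental_aeval (F : Subfield ℂ) {x : ℂ} (hx : Transcendental F x) {p : F[X]}
    (hp : 0 < p.natDegree) : Transcendental ℚ (aeval x p) := by
  intro h
  refine hx.aeval p hp.ne' (by simp [ne_zero_of_natDegree_gt hp]) (?_ : IsAlgebraic F _)
  exact h.extendScalars (algebraMap ℚ F).injective

theorem exists_unit_zpow_iff {θ : ℂˣ} (hθ : Transcendental ℚ (θ : ℂ)) (m : ℕ) :
    ∃ z : ℂˣ, (∀ k : ℤ, z ^ k = 1 ∨ z ^ k = -1 ↔ (m : ℤ) ∣ k) ∧ (m = 0 → z = θ) := by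
  have hsq : ∀ w : ℂˣ, w = 1 ∨ w = -1 ↔ w ^ 2 = 1 := fun w => by
    rw [Units.ext_iff, Units.ext_iff, Units.ext_iff, Units.val_neg, Units.val_pow_eq_pow_val,
      Units.val_one, sq_eq_one_iff]
  rcases Nat.eq_zero_or_pos m with rfl | hm
  · refine ⟨θ, fun k => ?_, fun _ => rfl⟩
    rw [hsq, Nat.cast_zero, zero_dvd_iff]
    constructor
    · intro h
      by_contra hk
      have := transcendental_zpow hθ (mul_ne_zero hk two_ne_zero)
      rw [_root_.zpow_mul] at this
      refine this ?_
      norm_cast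
      rw [h]
      exact isAlgebraic_one
    · rintro rfl; simp
  · have hprim := Complex.isPrimitiveRoot_exp (2 * m) (by omega)
    obtain ⟨z, hz⟩ := hprim.isUnit (by omega)
    rw [← hz, IsPrimitiveRoot.coe_units_iff] at hprim
    refine ⟨z, fun k => ?_, fun h => by omega⟩
    rw [hsq, ← zpow_natCast, ← _root_.zpow_mul, hprim.zpow_eq_one_iff_dvd]
    push_cast
    rw [mul_comm k]
    exact mul_dvd_mul_iff_left two_ne_zero

end Transcendence

section FactorRepresentations

theorem coe_diagSL {K : Type*} [Field K] (z : Kˣ) :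
    (diagSL z).1 = !![(z : K), 0; 0, ((z⁻¹ : Kˣ) : K)] := rfl

theorem inv_diagSL {K : Type*} [Field K] (z : Kˣ) : (diagSL z)⁻¹ = diagSL z⁻¹ := by
  apply Subtype.ext
  rw [Matrix.SpecialLinearGroup.coe_inv]
  simp [diagSL, Matrix.adjugate_fin_two]

theorem slMap_diagSL {K L : Type*} [Field K] [Field L] (f : K →+* L) (z : Kˣ) :
    Matrix.SpecialLinearGroup.map f (diagSL z) = diagSL (Units.map f.toMonoidHom z) := by
  apply Subtype.ext
  rw [Matrix.SpecialLinearGroup.map_apply_coe]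
  ext i j
  fin_cases i <;> fin_cases j <;> simp [diagSL]

theorem trace_commutator_diagSL {K : Type*} [Field K] (M : SL(2, K)) (z : Kˣ)
    (hM : M.1 0 1 * M.1 1 0 = 0) : (M * diagSL z * M⁻¹ * (diagSL z)⁻¹).1.trace = 2 := by
  have hdet := M.2
  rw [Matrix.det_fin_two] at hdet
  have hz : (z : K) * ((z⁻¹ : Kˣ) : K) = 1 := by simp
  have h : ∀ a b c d e e' : K, Matrix.trace (!![a, b; c, d] * !![e, 0; 0, e'] * !![d, -b; -c, a] *
      !![e', 0; 0, e]) = 2 * (a * d * (e * e')) - b * c * (e ^ 2 + e' ^ 2) := by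
    intros
    simp [Matrix.trace_fin_two]
    ring
  rw [inv_diagSL]
  rw [Matrix.SpecialLinearGroup.coe_mul, Matrix.SpecialLinearGroup.coe_mul,
    Matrix.SpecialLinearGroup.coe_mul, Matrix.SpecialLinearGroup.coe_inv, Matrix.adjugate_fin_two,
    coe_diagSL, coe_diagSL, inv_inv]
  nth_rewrite 1 [Matrix.eta_fin_two M.1]
  rw [h, hz, hM]
  linear_combination 2 * hdet + 2 * hM

/-- An element with an upper or lower triangular image commutes with an element with diagonal image,
provided that nontrivial elements do not have trace `2`. -/
theorem commute_of_triangular {K Γ : Type*} [Field K] [Group Γ] (ρ : Γ →* PSL(2, K))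
    (htr : ∀ g, g ≠ 1 → ∀ M : SL(2, K), toPSL M = ρ g → M.1.trace ≠ 2) {u g : Γ} {z : Kˣ}
    (hu : ρ u = toPSL (diagSL z)) {M : SL(2, K)} (hM : toPSL M = ρ g)
    (h : M.1 0 1 * M.1 1 0 = 0) : g * u = u * g := by
  have key : g * u * g⁻¹ * u⁻¹ = 1 := by
    by_contra hne
    refine htr _ hne (M * diagSL z * M⁻¹ * (diagSL z)⁻¹) ?_ (trace_commutator_diagSL M z h)
    simp only [map_mul, map_inv, hM, hu]
  rw [mul_inv_eq_one, mul_inv_eq_iff_eq_mul] at key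
  exact key

theorem exists_rep_diagSL {n : ℕ} {θ : ℂˣ} (hθ : Transcendental ℚ (θ : ℂ)) (f : Fin n → ℕ)
    {u : CyclicProd f} (hu : ¬ IsOfFinOrder u) :
    ∃ ρ : CyclicProd f →* PSL(2, ℂ), Function.Injective ρ ∧ ρ u = toPSL (diagSL θ) ∧
      (¬ IsProperPower u → ∀ g, g ∉ Subgroup.zpowers u → ∀ M : SL(2, ℂ), toPSL M = ρ g →
        M.1 0 1 ≠ 0 ∧ M.1 1 0 ≠ 0) := by
  choose z hz hz0 using fun i => exists_unit_zpow_iff hθ (f i)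
  let F : Subfield ℂ := Subfield.closure (Set.range fun i => (z i : ℂ))
  have hF : Cardinal.mk F ≤ Cardinal.aleph0 :=
    (Subfield.cardinalMk_closure_le_max _).trans (max_le (Cardinal.mk_le_aleph0) le_rfl)
  obtain ⟨x, hx⟩ := exists_transcendental_of_countable F hF
  let ev : F[X] →+* ℂ := (aeval x : F[X] →ₐ[F] ℂ).toRingHom
  have hev : Function.Injective ev := transcendental_iff_injective.1 hx
  let s : Fin n → F := fun i => ((i : ℕ) : F)
  have hs : Function.Injective s := fun i j h => Fin.ext (Nat.cast_injective h)
  let ζ : Fin n → Fˣ := fun i =>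
    Units.mk0 ⟨z i, Subfield.subset_closure ⟨i, rfl⟩⟩
      (fun h => (z i).ne_zero (congrArg Subtype.val h))
  have hζz : ∀ i, Units.map (algebraMap F ℂ).toMonoidHom (ζ i) = z i := fun i => Units.ext rfl
  have hinj : Function.Injective (Units.map (algebraMap F ℂ).toMonoidHom) :=
    Units.map_injective (algebraMap F ℂ).injective
  have hneg : Units.map (algebraMap F ℂ).toMonoidHom (-1) = -1 := Units.ext (by simp)
  have hζ : ∀ i (k : ℤ), ζ i ^ k = 1 ∨ ζ i ^ k = -1 ↔ (f i : ℤ) ∣ k := fun i k => by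
    rw [← hz, ← hζz, ← map_zpow, ← hneg, hinj.eq_iff]
    rw [← hinj.eq_iff (b := 1), map_one]
  obtain ⟨e, he⟩ := exists_cyclicProd_equiv (s := s) hev hζ
  have hfin : ¬ IsOfFinOrder (e u) := by
    rwa [← MulEquiv.coe_toMonoidHom, Function.Injective.isOfFinOrder_iff (f := e.toMonoidHom)
      e.injective]
  have hu1 : e u ≠ 1 := fun h => hfin (h ▸ IsOfFinOrder.one)
  obtain ⟨A, hA, hcase⟩ := exists_lift_trace hev hs hu1
  obtain ⟨lam, hlam, htrace⟩ : ∃ lam : ℂˣ, Transcendental ℚ (lam : ℂ) ∧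
      A.1.trace = lam + (lam⁻¹ : ℂˣ) := by
    rcases hcase with ⟨i, k, hconj, h1, -, htr⟩ | ⟨p, hp, htr⟩
    · have hk : k ≠ 0 := by
        rintro rfl
        exact h1 (zpow_zero _)
      have hfi : f i = 0 := by
        by_contra hfi
        have hgen : cycGen s ζ ev i ^ (k * f i) = 1 :=
          (cycGen_zpow_eq_one_iff s ζ ev hev i _).2 ((hζ i _).2 (dvd_mul_left _ _))
        refine hfin (hconj.symm.isOfFinOrder (MonoidHom.isOfFinOrder _ ?_))
        refine isOfFinOrder_iff_pow_eq_one.2 ⟨f i, Nat.pos_of_ne_zero hfi, ?_⟩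
        rw [← zpow_natCast, ← _root_.zpow_mul, hgen]
      refine ⟨θ ^ k, transcendental_zpow hθ hk, ?_⟩
      rw [htr, ← hz0 i hfi, ← hζz]
      rw [← map_zpow, ← map_inv]
      exact aeval_C _ _
    · obtain ⟨lam, hlam⟩ := exists_unit_add_inv_eq A.1.trace
      refine ⟨lam, transcendental_of_add_inv ?_, hlam⟩
      rw [← hlam, htr]
      exact transcendental_aeval F hx hp
  have hlam2 : (lam : ℂ) ^ 2 ≠ 1 := fun h => hlam (IsAlgebraic.of_pow two_pos (h ▸ isAlgebraic_one))
  obtain ⟨Q, hQ⟩ := exists_conj_eq_diagSL A lam hlam2 htrace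
  obtain ⟨σ, hσ⟩ := exists_ringEquiv_map_eq hlam hθ
  let ρ : CyclicProd f →* PSL(2, ℂ) :=
    (pslMap (σ : ℂ →+* ℂ)).comp ((MulAut.conj (toPSL Q)).toMonoidHom.comp
      ((genRep s ζ ev).comp e.toMonoidHom))
  have hρ : ∀ g, ρ g = pslMap (σ : ℂ →+* ℂ) (toPSL Q * genRep s ζ ev (e g) * (toPSL Q)⁻¹) :=
    fun g => rfl
  have hρu : ρ u = toPSL (diagSL θ) := by
    rw [hρ, ← hA, ← map_inv, ← map_mul, ← map_mul, hQ, pslMap_toPSL]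
    rw [slMap_diagSL]
    congr 2
    exact Units.ext hσ
  refine ⟨ρ, (pslMap_injective _).comp ((MulAut.conj (toPSL Q)).injective.comp
    ((genRep_injective hev hs).comp e.injective)), hρu, fun hp g hg M hM => ?_⟩
  rw [← mul_ne_zero_iff]
  intro h0
  refine hg ?_
  have hcomm := commute_of_triangular ρ ?_ hρu hM h0
  · have := mem_zpowers_of_commute hev hs hu1 (fun h => hp ((isProperPower_map_iff e u).1 h))
      (g := e g) (by rw [← map_mul, hcomm, map_mul])
    obtain ⟨k, hk⟩ := Subgroup.mem_zpowers_iff.1 this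
    rw [← map_zpow] at hk
    exact ⟨k, e.injective hk⟩
  · intro g hg M hM htr
    have h := trace_ne_two hev hs (g := e g) (by simpa using hg)
      (M := Q⁻¹ * Matrix.SpecialLinearGroup.map (σ.symm : ℂ →+* ℂ) M * Q) ?_
    · refine h ?_
      rw [Matrix.SpecialLinearGroup.coe_mul, Matrix.trace_mul_comm,
        ← Matrix.SpecialLinearGroup.coe_mul, ← mul_assoc, mul_inv_cancel, one_mul]
      rw [Matrix.trace_fin_two] at htr ⊢
      simpa [← map_add, htr] using map_ofNat σ.symm 2
    · have hid : Matrix.SpecialLinearGroup.map (σ : ℂ →+* ℂ)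
          (Matrix.SpecialLinearGroup.map (σ.symm : ℂ →+* ℂ) M) = M := by
        ext i j
        simp
      refine pslMap_injective (σ : ℂ →+* ℂ) ?_
      simp only [map_mul, map_inv]
      rw [pslMap_toPSL _ (Matrix.SpecialLinearGroup.map _ M), hid, hM, hρ]
      simp only [map_mul, map_inv]
      group

end FactorRepresentations

section PingPong

variable {G : Type*} [Group G]

/-- Alternating products of elements of `H true` and `H false` outside `A`; the two parameters
record the factors containing the first and the last syllable. -/
inductive IsAlternating (H : Bool → Subgroup G) (A : Subgroup G) : Bool → Bool → G → Prop
  | base {b : Bool} {h : G} : h ∈ H b → h ∉ A → IsAlternating H A b b h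
  | step {a b : Bool} {w h : G} : IsAlternating H A a b w → h ∈ H (!b) → h ∉ A →
      IsAlternating H A a (!b) (w * h)

variable {H : Bool → Subgroup G} {A : Subgroup G}

theorem IsAlternating.mul_mem (hA : ∀ b, A ≤ H b) {a b : Bool} {w h : G}
    (hw : IsAlternating H A a b w) (hh : h ∈ A) : IsAlternating H A a b (w * h) := by
  cases hw with
  | base h1 h2 => exact .base (Subgroup.mul_mem _ h1 (hA _ hh)) (by rwa [mul_mem_cancel_right hh])
  | step hw h1 h2 =>
    rw [mul_assoc]
    exact .step hw (Subgroup.mul_mem _ h1 (hA _ hh)) (by rwa [mul_mem_cancel_right hh])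

theorem mul_mem_or_isAlternating (hA : ∀ b, A ≤ H b) {x h : G} {b : Bool} (hh : h ∈ H b)
    (hx : x ∈ A ∨ ∃ a c, IsAlternating H A a c x) :
    x * h ∈ A ∨ ∃ a c, IsAlternating H A a c (x * h) := by
  rcases hx with hx | ⟨a, c, hx⟩
  · by_cases hhA : h ∈ A
    · exact Or.inl (Subgroup.mul_mem _ hx hhA)
    · exact Or.inr ⟨b, b, .base (Subgroup.mul_mem _ (hA b hx) hh) (by rwa [mul_mem_cancel_left hx])⟩
  · by_cases hhA : h ∈ A
    · exact Or.inr ⟨a, c, hx.mul_mem hA hhA⟩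
    · by_cases hcb : c = b
      · subst hcb
        cases hx with
        | base h1 h2 =>
          by_cases hxA : x * h ∈ A
          · exact Or.inl hxA
          · exact Or.inr ⟨_, _, .base (Subgroup.mul_mem _ h1 hh) hxA⟩
        | @step _ w y hw h1 h2 =>
          rw [mul_assoc]
          by_cases hyA : y * h ∈ A
          · exact Or.inr ⟨_, _, hw.mul_mem hA hyA⟩
          · exact Or.inr ⟨_, _, .step hw (Subgroup.mul_mem _ h1 hh) hyA⟩
      · obtain rfl : b = !c := by cases b <;> cases c <;> simp_all
        exact Or.inr ⟨_, _, .step hx hh hhA⟩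

theorem mem_or_isAlternating (hA : ∀ b, A ≤ H b) (htop : H true ⊔ H false = ⊤) (g : G) :
    g ∈ A ∨ ∃ a c, IsAlternating H A a c g := by
  have hg : g ∈ Subgroup.closure ((H true : Set G) ∪ H false) := by
    rw [Subgroup.closure_union, Subgroup.closure_eq, Subgroup.closure_eq, htop]
    exact Subgroup.mem_top g
  induction hg using Subgroup.closure_induction_right with
  | one => exact Or.inl (one_mem A)
  | mul_right x _ y hy ih =>
    rcases hy with hy | hy <;> exact mul_mem_or_isAlternating hA hy ih
  | mul_inv_cancel x _ y hy ih =>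
    rcases hy with hy | hy <;> exact mul_mem_or_isAlternating hA (inv_mem hy) ih

variable {K Γ₀ : Type*} [Field K] [LinearOrderedCommGroupWithZero Γ₀]

/-- The growth condition on the row `(p, q)` of a matrix representing an alternating product. -/
def RowBound (v : Valuation K Γ₀) : Bool → Bool → K → K → Prop
  | a, true, p, q => v q ≤ v p ∧ 1 ≤ v p ∧ (a = false → 1 < v p)
  | _, false, p, q => v p < v q ∧ 1 < v q

/-- The row of a matrix which is followed through an alternating product. -/
def rowIndex : Bool → Fin 2
  | true => 1
  | false => 0

/-- A ping-pong criterion for the faithfulness of a representation of an amalgamated product. -/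
theorem injective_of_pingPong (v : Valuation K Γ₀) (ρ : G →* PSL(2, K)) (hA : ∀ b, A ≤ H b)
    (htop : H true ⊔ H false = ⊤) (hinj : ∀ g ∈ A, ρ g = 1 → g = 1)
    (h₁ : ∀ g ∈ H true, g ∉ A → ∃ M : SL(2, K), toPSL M = ρ g ∧
      v (M.1 0 0) ≤ 1 ∧ v (M.1 0 1) ≤ 1 ∧ v (M.1 1 0) = 1 ∧ v (M.1 1 1) ≤ 1)
    (h₂ : ∀ g ∈ H false, g ∉ A → ∃ M : SL(2, K), toPSL M = ρ g ∧
      v (M.1 0 0) ≤ 1 ∧ 1 < v (M.1 0 1) ∧ v (M.1 1 0) ≤ 1 ∧ v (M.1 1 1) ≤ 1) :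
    Function.Injective ρ := by
  have key : ∀ {a b g}, IsAlternating H A a b g → ∃ M : SL(2, K), toPSL M = ρ g ∧
      RowBound v a b (M.1 (rowIndex a) 0) (M.1 (rowIndex a) 1) := by
    intro a b g hg
    induction hg with
    | @base h hh hhA =>
      cases a with
      | true =>
        obtain ⟨M, hM, -, -, h10, h11⟩ := h₁ h hh hhA
        exact ⟨M, hM, h11.trans h10.ge, h10.ge, by simp⟩
      | false =>
        obtain ⟨M, hM, h00, h01, -, -⟩ := h₂ h hh hhA
        exact ⟨M, hM, h00.trans_lt h01, h01⟩
    | @step b w h hw hh hhA ih =>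
      obtain ⟨N, hN, hrow⟩ := ih
      have hmul : ∀ (M : SL(2, K)) i j, (N * M).1 i j = N.1 i 0 * M.1 0 j + N.1 i 1 * M.1 1 j := by
        intro M i j
        rw [Matrix.SpecialLinearGroup.coe_mul, Matrix.mul_apply, Fin.sum_univ_two]
      generalize rowIndex a = r at *
      cases b with
      | true =>
        obtain ⟨M, hM, h00, h01, h10, h11⟩ := h₂ h hh hhA
        refine ⟨N * M, by rw [map_mul, map_mul, hN, hM], ?_⟩
        rw [hmul, hmul]
        obtain ⟨hqp, hp, -⟩ := hrow
        have hp0 : 0 < v (N.1 r 0) := zero_lt_one.trans_le hp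
        have e1 : v (N.1 r 0) < v (N.1 r 0 * M.1 0 1) := by
          rw [map_mul]
          exact lt_mul_of_one_lt_right hp0 h01
        have e2 : v (N.1 r 1 * M.1 1 1) ≤ v (N.1 r 0) := by
          rw [map_mul]
          exact (mul_le_of_le_one_right' h11).trans hqp
        have e3 : v (N.1 r 0 * M.1 0 0 + N.1 r 1 * M.1 1 0) ≤ v (N.1 r 0) := by
          refine v.map_add_le ?_ ?_ <;> rw [map_mul]
          · exact mul_le_of_le_one_right' h00
          · exact (mul_le_of_le_one_right' h10).trans hqp
        have e4 := v.map_add_eq_of_lt_left (e2.trans_lt e1)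
        exact ⟨by rw [e4]; exact e3.trans_lt e1, by rw [e4]; exact hp.trans_lt e1⟩
      | false =>
        obtain ⟨M, hM, h00, h01, h10, h11⟩ := h₁ h hh hhA
        refine ⟨N * M, by rw [map_mul, map_mul, hN, hM], ?_⟩
        rw [hmul, hmul]
        obtain ⟨hpq, hq⟩ := hrow
        have e1 : v (N.1 r 1 * M.1 1 0) = v (N.1 r 1) := by rw [map_mul, h10, mul_one]
        have e2 : v (N.1 r 0 * M.1 0 0) < v (N.1 r 1) := by
          rw [map_mul]
          exact (mul_le_of_le_one_right' h00).trans_lt hpq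
        have e3 : v (N.1 r 0 * M.1 0 1 + N.1 r 1 * M.1 1 1) ≤ v (N.1 r 1) := by
          refine v.map_add_le ?_ ?_ <;> rw [map_mul]
          · exact (mul_le_of_le_one_right' h01).trans hpq.le
          · exact mul_le_of_le_one_right' h11
        have e4 : v (N.1 r 0 * M.1 0 0 + N.1 r 1 * M.1 1 0) = v (N.1 r 1) := by
          rw [← e1] at e2 ⊢
          exact v.map_add_eq_of_lt_right e2
        exact ⟨by rw [e4]; exact e3, by rw [e4]; exact hq.le, fun _ => by rw [e4]; exact hq⟩
  rw [injective_iff_map_eq_one]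
  intro g hg
  rcases mem_or_isAlternating hA htop g with hgA | ⟨a, b, hgalt⟩
  · exact hinj g hgA hg
  exfalso
  obtain ⟨M, hM, hrow⟩ := key hgalt
  rw [hg, toPSL_eq_one_iff] at hM
  rcases hM with rfl | rfl <;> cases a <;> cases b <;> simp [RowBound, rowIndex] at hrow

end PingPong

section Gluing

theorem hom_eq_of_letters {α Γ : Type*} [DecidableEq α] [Group Γ] (P : α → Prop)
    (φ ψ : FreeGroup α →* Γ) (h : ∀ i, P i → φ (FreeGroup.of i) = ψ (FreeGroup.of i))
    {w : FreeGroup α} (hw : ∀ x ∈ w.toWord, P x.1) : φ w = ψ w := by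
  rw [← FreeGroup.lift.apply_symm_apply φ, ← FreeGroup.lift.apply_symm_apply ψ,
    ← FreeGroup.mk_toWord (x := w), FreeGroup.lift_mk, FreeGroup.lift_mk]
  congr 1
  refine List.map_congr_left fun x hx => ?_
  have hx' := h x.1 (hw x hx)
  simp only [FreeGroup.lift_symm_apply, Function.comp_apply, hx']

variable {n : ℕ} {e : Fin n → ℕ} {P : Fin n → Prop} [DecidablePred P]

/-- The exponents of the free product of the cyclic groups indexed by `P`, presented on all
generators. -/
def factorExp (e : Fin n → ℕ) (P : Fin n → Prop) [DecidablePred P] (i : Fin n) : ℕ :=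
  if P i then e i else 1

theorem factorExp_pos {i : Fin n} (hi : P i) : factorExp e P i = e i := if_pos hi

theorem factorExp_neg {i : Fin n} (hi : ¬ P i) : factorExp e P i = 1 := if_neg hi

theorem of_eq_one_of_not {i : Fin n} (hi : ¬ P i) :
    (PresentedGroup.of i : CyclicProd (factorExp e P)) = 1 := by
  have h := cyclicProd_of_pow (factorExp e P) i
  rwa [factorExp_neg hi, pow_one] at h

theorem factorRels_eq : {w : FreeGroup (Fin n) | ∃ i, P i ∧ w = FreeGroup.of i ^ e i} ∪
      {w | ∃ i, ¬ P i ∧ w = FreeGroup.of i} =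
    {w | ∃ i, w = FreeGroup.of i ^ factorExp e P i} := by
  ext w
  constructor
  · rintro (⟨i, hi, rfl⟩ | ⟨i, hi, rfl⟩)
    · exact ⟨i, by rw [factorExp_pos hi]⟩
    · exact ⟨i, by rw [factorExp_neg hi, pow_one]⟩
  · rintro ⟨i, rfl⟩
    by_cases hi : P i
    · exact Or.inl ⟨i, hi, by rw [factorExp_pos hi]⟩
    · exact Or.inr ⟨i, hi, by rw [factorExp_neg hi, pow_one]⟩

variable {R : Set (FreeGroup (Fin n))}

theorem exists_factor_hom (P : Fin n → Prop) [DecidablePred P]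
    (hR : ∀ i, FreeGroup.of i ^ e i ∈ R) :
    ∃ ι : CyclicProd (factorExp e P) →* PresentedGroup R,
      (∀ i, P i → ι (PresentedGroup.of i) = PresentedGroup.of i) ∧
      ∀ w : FreeGroup (Fin n), (∀ x ∈ w.toWord, P x.1) →
        ι (PresentedGroup.mk _ w) = PresentedGroup.mk R w := by
  let ι : CyclicProd (factorExp e P) →* PresentedGroup R :=
    PresentedGroup.toGroup (f := fun i => if P i then PresentedGroup.of i else 1) (by
      rintro _ ⟨i, rfl⟩
      rw [map_pow, FreeGroup.lift_apply_of]
      by_cases hi : P i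
      · rw [if_pos hi, factorExp_pos hi]
        exact PresentedGroup.one_of_mem (hR i)
      · rw [if_neg hi, one_pow])
  have hι : ∀ i, P i → ι (PresentedGroup.of i) = PresentedGroup.of i := fun i hi =>
    (PresentedGroup.toGroup.of _).trans (if_pos hi)
  exact ⟨ι, hι, fun w hw => hom_eq_of_letters P (ι.comp (PresentedGroup.mk _))
    (PresentedGroup.mk R) hι hw⟩

theorem exists_glue {U V : FreeGroup (Fin n)} {Γ : Type*} [Group Γ]
    (hU : ∀ x ∈ U.toWord, P x.1) (hV : ∀ x ∈ V.toWord, ¬ P x.1)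
    (ρ₁ : CyclicProd (factorExp e P) →* Γ) (ρ₂ : CyclicProd (factorExp e fun i => ¬ P i) →* Γ)
    (h : ρ₁ (PresentedGroup.mk _ U) * ρ₂ (PresentedGroup.mk _ V) = 1) :
    ∃ ρ : PresentedGroup ({w | ∃ i, w = FreeGroup.of i ^ e i} ∪ {U * V}) →* Γ,
      (∀ i, P i → ρ (PresentedGroup.of i) = ρ₁ (PresentedGroup.of i)) ∧
      ∀ i, ¬ P i → ρ (PresentedGroup.of i) = ρ₂ (PresentedGroup.of i) := by
  let f : Fin n → Γ := fun i =>
    if P i then ρ₁ (PresentedGroup.of i) else ρ₂ (PresentedGroup.of i)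
  have hfU : FreeGroup.lift f U = ρ₁ (PresentedGroup.mk _ U) :=
    hom_eq_of_letters P (FreeGroup.lift f) (ρ₁.comp (PresentedGroup.mk _))
      (fun i hi => by rw [FreeGroup.lift_apply_of]; exact if_pos hi) hU
  have hfV : FreeGroup.lift f V = ρ₂ (PresentedGroup.mk _ V) :=
    hom_eq_of_letters (fun i => ¬ P i) (FreeGroup.lift f) (ρ₂.comp (PresentedGroup.mk _))
      (fun i hi => by rw [FreeGroup.lift_apply_of]; exact if_neg hi) hV
  refine ⟨PresentedGroup.toGroup (f := f) ?_, fun i hi => ?_, fun i hi => ?_⟩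
  · rintro _ (⟨i, rfl⟩ | rfl)
    · rw [map_pow, FreeGroup.lift_apply_of]
      by_cases hi : P i
      · have h1 := cyclicProd_of_pow (factorExp e P) i
        rw [factorExp_pos hi] at h1
        simp only [f]
        rw [if_pos hi, ← map_pow, h1, map_one]
      · have h1 := cyclicProd_of_pow (factorExp e fun i => ¬ P i) i
        rw [factorExp_pos (P := fun i => ¬ P i) hi] at h1
        simp only [f]
        rw [if_neg hi, ← map_pow, h1, map_one]
    · rw [map_mul, hfU, hfV, h]
  · exact (PresentedGroup.toGroup.of _).trans (if_pos hi)
  · exact (PresentedGroup.toGroup.of _).trans (if_neg hi)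

theorem comp_eq_of_agree {Γ : Type*} [Group Γ] {ι : CyclicProd (factorExp e P) →* PresentedGroup R}
    (hι : ∀ i, P i → ι (PresentedGroup.of i) = PresentedGroup.of i) {ρ : PresentedGroup R →* Γ}
    {ρ' : CyclicProd (factorExp e P) →* Γ}
    (hρ : ∀ i, P i → ρ (PresentedGroup.of i) = ρ' (PresentedGroup.of i)) : ρ.comp ι = ρ' := by
  refine PresentedGroup.ext fun i => ?_
  by_cases hi : P i
  · rw [MonoidHom.comp_apply, hι i hi, hρ i hi]
  · rw [of_eq_one_of_not hi, map_one, map_one]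

theorem closure_le_range {ι : CyclicProd (factorExp e P) →* PresentedGroup R}
    (hι : ∀ i, P i → ι (PresentedGroup.of i) = PresentedGroup.of i) :
    Subgroup.closure {g : PresentedGroup R | ∃ i, P i ∧ g = PresentedGroup.of i} ≤ ι.range := by
  rw [Subgroup.closure_le]
  rintro _ ⟨i, hi, rfl⟩
  exact ⟨PresentedGroup.of i, hι i hi⟩

theorem injOn_range {Γ Δ Λ : Type*} [Group Γ] [Group Δ] [Group Λ] {ι : Γ →* Δ} {ρ : Δ →* Λ}
    {ρ' : Γ →* Λ} (h : ρ.comp ι = ρ') (hρ' : Function.Injective ρ') :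
    Set.InjOn ρ (ι.range : Set Δ) := by
  rintro _ ⟨x, rfl⟩ _ ⟨y, rfl⟩ hxy
  subst h
  rw [hρ' hxy]

end Gluing

section Amalgam

open scoped Classical

theorem exists_ringHom_ratFunc : Nonempty (RatFunc ℂ →+* ℂ) := by
  have h1 : Cardinal.mk (AlgebraicClosure (RatFunc ℂ)) ≤ Cardinal.mk ℂ := by
    refine (Algebra.IsAlgebraic.cardinalMk_le_max (RatFunc ℂ) _).trans (max_le ?_ ?_)
    · refine (IsLocalization.cardinalMk_le (L := RatFunc ℂ) (nonZeroDivisors ℂ[X])).trans ?_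
      exact Polynomial.cardinalMk_le_max.trans (max_le le_rfl (Cardinal.aleph0_le_mk ℂ))
    · exact Cardinal.aleph0_le_mk ℂ
  have h2 : Cardinal.mk ℂ ≤ Cardinal.mk (AlgebraicClosure (RatFunc ℂ)) :=
    Cardinal.mk_le_of_injective
      (f := (algebraMap (RatFunc ℂ) (AlgebraicClosure (RatFunc ℂ))).comp RatFunc.C)
      (RingHom.injective _)
  obtain ⟨E⟩ := IsAlgClosed.ringEquiv_of_equiv_of_charZero (K := ℂ)
    (L := AlgebraicClosure (RatFunc ℂ))
    (by rw [Cardinal.mk_complex]; exact Cardinal.aleph0_lt_continuum)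
    (Cardinal.eq.1 (h2.antisymm h1))
  exact ⟨E.symm.toRingHom.comp (algebraMap _ _)⟩

theorem inftyValuation_C {c : ℂ} (hc : c ≠ 0) :
    RatFunc.inftyValuation ℂ (RatFunc.C c) = 1 :=
  RatFunc.inftyValuation.C ℂ hc

theorem inftyValuation_C_le (c : ℂ) : RatFunc.inftyValuation ℂ (RatFunc.C c) ≤ 1 := by
  by_cases hc : c = 0
  · simp [hc]
  · rw [inftyValuation_C hc]

/-- The matrix `diag(T, T⁻¹)` over the field of rational functions in `T`. -/
noncomputable def twist : SL(2, RatFunc ℂ) := diagSL (Units.mk0 RatFunc.X RatFunc.X_ne_zero)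

theorem coe_twist_conj (N : SL(2, RatFunc ℂ)) : (twist * N * twist⁻¹).1 =
    !![N.1 0 0, RatFunc.X * N.1 0 1 * RatFunc.X; RatFunc.X⁻¹ * N.1 1 0 * RatFunc.X⁻¹, N.1 1 1] := by
  have hX : (RatFunc.X : RatFunc ℂ) ≠ 0 := RatFunc.X_ne_zero
  rw [twist, inv_diagSL, Matrix.SpecialLinearGroup.coe_mul, Matrix.SpecialLinearGroup.coe_mul,
    coe_diagSL, coe_diagSL]
  nth_rewrite 1 [Matrix.eta_fin_two N.1]
  ext i j
  fin_cases i <;> fin_cases j <;>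
    simp <;> field_simp

variable {Γ₁ Γ₂ G : Type*} [Group Γ₁] [Group Γ₂] [Group G]

/-- Two faithful representations of the factors of an amalgamated product over a cyclic group become
a faithful representation after a generic twist by diagonal matrices. -/
theorem injective_of_twist {ι₁ : Γ₁ →* G} {ι₂ : Γ₂ →* G} {u₁ : Γ₁} {u₂ : Γ₂}
    (hu : ι₁ u₁ = ι₂ u₂) (htop : ι₁.range ⊔ ι₂.range = ⊤)
    {ρ₁ : Γ₁ →* PSL(2, ℂ)} {ρ₂ : Γ₂ →* PSL(2, ℂ)} (hρ₁ : Function.Injective ρ₁)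
    (h₁ : ∀ g, g ∉ Subgroup.zpowers u₁ → ∀ M : SL(2, ℂ), toPSL M = ρ₁ g → M.1 1 0 ≠ 0)
    (h₂ : ∀ g, g ∉ Subgroup.zpowers u₂ → ∀ M : SL(2, ℂ), toPSL M = ρ₂ g → M.1 0 1 ≠ 0)
    {ρ : G →* PSL(2, RatFunc ℂ)} (hc₁ : ρ.comp ι₁ = (pslMap RatFunc.C).comp ρ₁)
    (hc₂ : ρ.comp ι₂ = (MulAut.conj (toPSL twist)).toMonoidHom.comp ((pslMap RatFunc.C).comp ρ₂)) :
    Function.Injective ρ := by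
  let H : Bool → Subgroup G := fun b => if b then ι₁.range else ι₂.range
  refine injective_of_pingPong (H := H) (A := Subgroup.zpowers (ι₁ u₁))
    (RatFunc.inftyValuation ℂ) ρ ?_ htop ?_ ?_ ?_
  · intro b
    rw [Subgroup.zpowers_le]
    cases b
    · exact ⟨u₂, hu.symm⟩
    · exact ⟨u₁, rfl⟩
  · rintro _ ⟨k, rfl⟩ h
    have h' : ρ.comp ι₁ (u₁ ^ k) = 1 := by simpa using h
    rw [hc₁] at h'
    have h1 : u₁ ^ k = 1 := hρ₁ (pslMap_injective _ (h'.trans (by rw [map_one, map_one])))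
    change ι₁ u₁ ^ k = 1
    rw [← map_zpow, h1, map_one]
  · rintro _ ⟨x, rfl⟩ hx
    have hx' : x ∉ Subgroup.zpowers u₁ := by
      rintro ⟨k, rfl⟩
      exact hx ⟨k, (map_zpow _ _ _).symm⟩
    obtain ⟨M, hM⟩ := toPSL_surjective (ρ₁ x)
    refine ⟨Matrix.SpecialLinearGroup.map RatFunc.C M, ?_, inftyValuation_C_le _,
      inftyValuation_C_le _, inftyValuation_C (h₁ x hx' M hM), inftyValuation_C_le _⟩
    rw [← MonoidHom.comp_apply ρ, hc₁, MonoidHom.comp_apply, ← hM, pslMap_toPSL]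
  · rintro _ ⟨x, rfl⟩ hx
    have hx' : x ∉ Subgroup.zpowers u₂ := by
      rintro ⟨k, rfl⟩
      exact hx ⟨k, by simp [hu]⟩
    obtain ⟨M, hM⟩ := toPSL_surjective (ρ₂ x)
    refine ⟨twist * Matrix.SpecialLinearGroup.map RatFunc.C M * twist⁻¹, ?_, ?_⟩
    · rw [← MonoidHom.comp_apply ρ, hc₂, MonoidHom.comp_apply, MonoidHom.comp_apply, ← hM,
        pslMap_toPSL, map_mul, map_mul, map_inv]
      rfl
    · rw [coe_twist_conj]
      have hX : 1 < RatFunc.inftyValuation ℂ RatFunc.X := by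
        rw [RatFunc.inftyValuation.X, ← WithZero.exp_zero, WithZero.exp_lt_exp]
        exact one_pos
      have hX' : (RatFunc.inftyValuation ℂ RatFunc.X)⁻¹ ≤ 1 := inv_le_one_of_one_le₀ hX.le
      refine ⟨inftyValuation_C_le _, ?_, ?_, inftyValuation_C_le _⟩
      · change 1 < RatFunc.inftyValuation ℂ (RatFunc.X * RatFunc.C (M.1 0 1) * RatFunc.X)
        rw [map_mul, map_mul, inftyValuation_C (h₂ x hx' M hM), mul_one]
        exact one_lt_mul'' hX hX
      · change RatFunc.inftyValuation ℂ (RatFunc.X⁻¹ * RatFunc.C (M.1 1 0) * RatFunc.X⁻¹) ≤ 1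
        rw [map_mul, map_mul, map_inv₀]
        exact mul_le_one' (mul_le_one' hX' (inftyValuation_C_le _)) hX'

theorem twist_conj_diagSL (z : ℂˣ) :
    MulAut.conj (toPSL twist) (pslMap RatFunc.C (toPSL (diagSL z))) =
      pslMap RatFunc.C (toPSL (diagSL z)) := by
  rw [pslMap_toPSL, MulAut.conj_apply, ← map_inv, ← map_mul, ← map_mul]
  congr 1
  apply Subtype.ext
  rw [coe_twist_conj]
  ext i j
  fin_cases i <;> fin_cases j <;> simp [slMap_diagSL, coe_diagSL]

end Amalgam

section Representations

variable {n : ℕ} {e : Fin n → ℕ} {P : Fin n → Prop} [DecidablePred P] {U V : FreeGroup (Fin n)}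

/-- The representations of an amalgamated product of two free products of cyclic groups, the
factors being presented on all the generators by `CyclicProd`. -/
theorem exists_rep_injOn_and_injective
    (hU : ∀ x ∈ U.toWord, P x.1) (hV : ∀ x ∈ V.toWord, ¬ P x.1)
    {u : CyclicProd (factorExp e P)} (hu : u = PresentedGroup.mk _ U)
    {v : CyclicProd (factorExp e fun i => ¬ P i)} (hv : v = PresentedGroup.mk _ V)
    (hufin : ¬ IsOfFinOrder u) (hvfin : ¬ IsOfFinOrder v)
    {R : Set (FreeGroup (Fin n))} (hR : R = {w | ∃ i, w = FreeGroup.of i ^ e i} ∪ {U * V}) :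
    (∃ ρ : PresentedGroup R →* PSL(2, ℂ),
      Set.InjOn ρ (Subgroup.closure {g : PresentedGroup R | ∃ i, P i ∧ g = PresentedGroup.of i} :
        Set (PresentedGroup R)) ∧
      Set.InjOn ρ (Subgroup.closure {g : PresentedGroup R | ∃ i, ¬ P i ∧ g = PresentedGroup.of i} :
        Set (PresentedGroup R))) ∧
    (¬ IsProperPower u → ¬ IsProperPower v →
      ∃ ρ : PresentedGroup R →* PSL(2, ℂ), Function.Injective ρ) := by
  obtain ⟨t, ht⟩ := exists_transcendental_rat
  have ht0 : t ≠ 0 := fun h => ht (h ▸ isAlgebraic_zero)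
  obtain ⟨θ, rfl⟩ := ht0.isUnit
  obtain ⟨ρ₁, hinj₁, hρ₁, hoff₁⟩ := exists_rep_diagSL ht _ hufin
  obtain ⟨ρ₂, hinj₂, hρ₂, hoff₂⟩ := exists_rep_diagSL ht _ (u := v⁻¹) (by
    rwa [isOfFinOrder_inv_iff])
  have hpow : ∀ i, FreeGroup.of i ^ e i ∈ R := fun i => hR ▸ Or.inl ⟨i, rfl⟩
  obtain ⟨ι₁, hι₁, hιU⟩ := exists_factor_hom P hpow
  obtain ⟨ι₂, hι₂, hιV⟩ := exists_factor_hom (fun i => ¬ P i) hpow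
  have hUV : PresentedGroup.mk R U * PresentedGroup.mk R V = 1 := by
    rw [← map_mul]
    exact PresentedGroup.one_of_mem (hR ▸ Or.inr rfl)
  subst hR
  constructor
  · obtain ⟨ρ, h₁, h₂⟩ := exists_glue (e := e) hU hV ρ₁ ρ₂ (by
      rw [← hu, ← hv, hρ₁, ← hρ₂, map_inv, inv_mul_cancel])
    exact ⟨ρ, (injOn_range (comp_eq_of_agree hι₁ h₁) hinj₁).mono (closure_le_range hι₁),
      (injOn_range (comp_eq_of_agree hι₂ h₂) hinj₂).mono (closure_le_range hι₂)⟩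
  · intro hup hvp
    obtain ⟨φ⟩ := exists_ringHom_ratFunc
    obtain ⟨ρ, h₁, h₂⟩ := exists_glue (e := e) hU hV ((pslMap RatFunc.C).comp ρ₁)
      ((MulAut.conj (toPSL twist)).toMonoidHom.comp ((pslMap RatFunc.C).comp ρ₂)) (by
        rw [← hu, ← hv, ← inv_inv v, map_inv _ v⁻¹, mul_inv_eq_one]
        change pslMap RatFunc.C (ρ₁ u) = MulAut.conj (toPSL twist) (pslMap RatFunc.C (ρ₂ v⁻¹))
        rw [hρ₁, hρ₂, twist_conj_diagSL])
    refine ⟨(pslMap φ).comp ρ, (pslMap_injective φ).comp ?_⟩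
    refine injective_of_twist (u₁ := u) (u₂ := v⁻¹) ?_ ?_ hinj₁
      (fun g hg M hM => (hoff₁ hup g hg M hM).2)
      (fun g hg M hM => (hoff₂ (fun h => hvp ((isProperPower_inv_iff v).1 h)) g hg M hM).1)
      (comp_eq_of_agree hι₁ h₁) (comp_eq_of_agree hι₂ h₂)
    · rw [map_inv, hu, hv, hιU U hU, hιV V hV, eq_inv_iff_mul_eq_one, hUV]
    · rw [eq_top_iff, ← PresentedGroup.closure_range_of, Subgroup.closure_le]
      rintro _ ⟨i, rfl⟩
      by_cases hi : P i
      · exact (le_sup_left : ι₁.range ≤ _) ⟨_, hι₁ i hi⟩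
      · exact (le_sup_right : ι₂.range ≤ _) ⟨_, hι₂ i hi⟩

/-- A version of `exists_rep_injOn_and_injective` in which the factors are presented by killing the
generators of the other factor. -/
theorem exists_rep_injOn_and_injective_of_relators {n : ℕ} {e : Fin n → ℕ} {P Q : Fin n → Prop}
    [DecidablePred P] (hQ : ∀ i, Q i ↔ ¬ P i) {U V : FreeGroup (Fin n)}
    (hU : ∀ x ∈ U.toWord, P x.1) (hV : ∀ x ∈ V.toWord, Q x.1)
    {R R₁ R₂ : Set (FreeGroup (Fin n))}
    (hR : R = {w | ∃ i, w = FreeGroup.of i ^ e i} ∪ {U * V})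
    (hR₁ : R₁ = {w | ∃ i, P i ∧ w = FreeGroup.of i ^ e i} ∪ {w | ∃ i, Q i ∧ w = FreeGroup.of i})
    (hR₂ : R₂ = {w | ∃ i, Q i ∧ w = FreeGroup.of i ^ e i} ∪ {w | ∃ i, P i ∧ w = FreeGroup.of i})
    (hufin : ¬ IsOfFinOrder (PresentedGroup.mk R₁ U))
    (hvfin : ¬ IsOfFinOrder (PresentedGroup.mk R₂ V)) :
    (∃ ρ : PresentedGroup R →* PSL(2, ℂ),
      Set.InjOn ρ (Subgroup.closure {g : PresentedGroup R | ∃ i, P i ∧ g = PresentedGroup.of i} :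
        Set (PresentedGroup R)) ∧
      Set.InjOn ρ (Subgroup.closure {g : PresentedGroup R | ∃ i, Q i ∧ g = PresentedGroup.of i} :
        Set (PresentedGroup R))) ∧
    (¬ IsProperPower (PresentedGroup.mk R₁ U) → ¬ IsProperPower (PresentedGroup.mk R₂ V) →
      ∃ ρ : PresentedGroup R →* PSL(2, ℂ), Function.Injective ρ) := by
  obtain rfl : Q = fun i => ¬ P i := funext fun i => propext (hQ i)
  have h₁ : R₁ = {w | ∃ i, w = FreeGroup.of i ^ factorExp e P i} := by
    rw [hR₁, ← factorRels_eq]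
  have h₂ : R₂ = {w | ∃ i, w = FreeGroup.of i ^ factorExp e (fun i => ¬ P i) i} := by
    rw [hR₂, ← factorRels_eq]
    simp only [not_not]
  subst h₁ h₂
  exact exists_rep_injOn_and_injective hU hV rfl rfl hufin hvfin hR

end Representations

end Preparation

/-- A group of F-type has a representation into `PSL(2, ℂ)` which is faithful
on both factors `G₁ = ⟨a_1, …, a_p⟩` and `G₂ = ⟨a_{p+1}, …, a_n⟩`; moreover if neither `U` nor
`V` is a proper power (in `G₁` resp. `G₂`), it has a faithful representation into `PSL(2, ℂ)`. -/
theorem fType_essential_psl2C_rep (D : FTypeBase) (hD : D.IsFType) :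
    (∃ ρ : D.Gp →* PSL(2, ℂ),
        Set.InjOn ρ (D.factor1 : Set D.Gp) ∧ Set.InjOn ρ (D.factor2 : Set D.Gp)) ∧
    (¬ IsProperPower D.imgU1 → ¬ IsProperPower D.imgV2 →
        ∃ ρ : D.Gp →* PSL(2, ℂ), Function.Injective ρ) := by
  obtain ⟨-, -, -, -, hU, hV, -, -, hUfin, hVfin, -, -⟩ := hD
  exact exists_rep_injOn_and_injective_of_relators (R := D.rels)
    (P := fun i : Fin D.n => (i : ℕ) < D.p)
    (Q := fun i : Fin D.n => D.p ≤ (i : ℕ)) (fun _ => not_lt.symm) hU hV rfl rfl rfl hUfin hVfin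

end FPaper
end

section
/- Let G be a group of F-type. Then every finite subgroup of G is cyclic and is conjugate in G to a subgroup of the cyclic subgroup ⟨a_i⟩ generated by the image of some generator a_i. -/
open scoped MatrixGroups

namespace Monoid.PushoutI

variable {ι : Type*} {G : ι → Type*} {B : Type*} [∀ i, Group (G i)] [Group B]

/-- The product in the amalgam of a list of syllables. -/
def syllableProd (φ : ∀ i, B →* G i) (l : List (Σ i, G i)) : PushoutI φ :=
  (l.map fun s => of s.1 s.2).prod

/-- A list of syllables is reduced if consecutive syllables lie in different factors and no
syllable lies in the amalgamated subgroup. -/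
def IsReducedList (φ : ∀ i, B →* G i) (l : List (Σ i, G i)) : Prop :=
  l.IsChain (fun s t => s.1 ≠ t.1) ∧ ∀ s ∈ l, s.2 ∉ (φ s.1).range

/-- The list of syllables representing the inverse. -/
def invSyllables (l : List (Σ i, G i)) : List (Σ i, G i) :=
  (l.map fun s => ⟨s.1, s.2⁻¹⟩).reverse

/-- An element has syllable length at most `n` if, up to the amalgamated subgroup, it is a product
of at most `n` syllables. -/
def SyllableLengthLE {φ : ∀ i, B →* G i} (n : ℕ) (x : PushoutI φ) : Prop :=
  ∃ a l, x = base φ a * syllableProd φ l ∧ l.length ≤ n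

variable {φ : ∀ i, B →* G i}

@[simp]
theorem syllableProd_nil : syllableProd φ [] = 1 := rfl

@[simp]
theorem syllableProd_cons (s : Σ i, G i) (l : List (Σ i, G i)) :
    syllableProd φ (s :: l) = of s.1 s.2 * syllableProd φ l := by
  simp [syllableProd]

@[simp]
theorem syllableProd_append (l l' : List (Σ i, G i)) :
    syllableProd φ (l ++ l') = syllableProd φ l * syllableProd φ l' := by
  simp [syllableProd]

@[simp]
theorem length_invSyllables (l : List (Σ i, G i)) : (invSyllables l).length = l.length := by
  simp [invSyllables]

@[simp]
theorem syllableProd_invSyllables (l : List (Σ i, G i)) :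
    syllableProd φ (invSyllables l) = (syllableProd φ l)⁻¹ := by
  induction l with
  | nil => simp [invSyllables]
  | cons s l ih =>
    have h : invSyllables (s :: l) = invSyllables l ++ [⟨s.1, s.2⁻¹⟩] := by simp [invSyllables]
    simp [h, ih]

theorem isReducedList_nil : IsReducedList φ [] := ⟨List.isChain_nil, by simp⟩

theorem isReducedList_cons {s : Σ i, G i} {l : List (Σ i, G i)} :
    IsReducedList φ (s :: l) ↔
      s.2 ∉ (φ s.1).range ∧ (∀ t ∈ l.head?, s.1 ≠ t.1) ∧ IsReducedList φ l := by
  simp only [IsReducedList, List.isChain_cons, List.forall_mem_cons]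
  tauto

theorem isReducedList_append {l l' : List (Σ i, G i)} :
    IsReducedList φ (l ++ l') ↔
      IsReducedList φ l ∧ IsReducedList φ l' ∧ ∀ s ∈ l.getLast?, ∀ t ∈ l'.head?, s.1 ≠ t.1 := by
  simp only [IsReducedList, List.isChain_append, List.forall_mem_append]
  tauto

theorem IsReducedList.invSyllables {l : List (Σ i, G i)} (h : IsReducedList φ l) :
    IsReducedList φ (invSyllables l) := by
  refine ⟨?_, ?_⟩
  · simp only [PushoutI.invSyllables, List.isChain_reverse, List.isChain_map]
    exact h.1.imp fun _ _ hab => hab.symm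
  · intro s hs
    simp only [PushoutI.invSyllables, List.mem_reverse, List.mem_map] at hs
    obtain ⟨t, ht, rfl⟩ := hs
    simpa using h.2 t ht

theorem getLast?_invSyllables (l : List (Σ i, G i)) :
    (invSyllables l).getLast? = l.head?.map fun s => ⟨s.1, s.2⁻¹⟩ := by
  simp [invSyllables]

/-- The factors visited by a reduced list are determined by the coset it represents. -/
theorem IsReducedList.map_fst_eq (hφ : ∀ i, Function.Injective (φ i)) {l l' : List (Σ i, G i)}
    (hl : IsReducedList φ l) (hl' : IsReducedList φ l') {a : B}
    (h : syllableProd φ l = base φ a * syllableProd φ l') :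
    l.map Sigma.fst = l'.map Sigma.fst := by
  classical
  obtain ⟨d⟩ := NormalWord.transversal_nonempty φ hφ
  have key (m : List (Σ i, G i)) (hm : IsReducedList φ m) :
      ∃ w : NormalWord d, w.prod = syllableProd φ m ∧
        w.toList.map Sigma.fst = m.map Sigma.fst := by
    obtain ⟨w, hw, hw'⟩ := Reduced.exists_normalWord_prod_eq (φ := φ) d
      (w := ⟨m, fun s hs h1 => hm.2 s hs (h1 ▸ one_mem _), hm.1⟩) hm.2
    refine ⟨w, ?_, hw'⟩
    rw [hw]
    simp [CoprodI.Word.prod, syllableProd, map_list_prod, Function.comp_def]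
  obtain ⟨w, hw, hwl⟩ := key l hl
  obtain ⟨w', hw', hwl'⟩ := key l' hl'
  have : w = a • w' := NormalWord.prod_injective (by simp [hw, hw', h])
  rw [← hwl, ← hwl', this]
  rfl

theorem exists_isReducedList (a : B) (l : List (Σ i, G i)) :
    ∃ a' l', IsReducedList φ l' ∧ l'.length ≤ l.length ∧
      base φ a * syllableProd φ l = base φ a' * syllableProd φ l' := by
  induction l generalizing a with
  | nil => exact ⟨a, [], isReducedList_nil, le_rfl, rfl⟩
  | cons s l ih =>
    obtain ⟨i, g⟩ := s
    obtain ⟨b, m, hm, hlen, heq⟩ := ih 1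
    have heq' : base φ a * syllableProd φ (⟨i, g⟩ :: l) =
        base φ a * (of i (g * φ i b) * syllableProd φ m) := by
      rw [map_one, one_mul] at heq
      simp [heq, mul_assoc, of_apply_eq_base]
    rw [heq']
    set t := g * φ i b
    by_cases ht : t ∈ (φ i).range
    · obtain ⟨c, hc⟩ := ht
      exact ⟨a * c, m, hm, by simp; omega, by rw [← hc]; simp [of_apply_eq_base, mul_assoc]⟩
    by_cases hi : ∀ u ∈ m.head?, i ≠ u.1
    · exact ⟨a, ⟨i, t⟩ :: m, isReducedList_cons.2 ⟨ht, hi, hm⟩, by simp; omega, by simp⟩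
    push Not at hi
    obtain ⟨⟨j, u⟩, hu, hij⟩ := hi
    obtain rfl : i = j := hij
    obtain ⟨m', rfl⟩ : ∃ m', m = ⟨i, u⟩ :: m' := by
      cases m with
      | nil => simp at hu
      | cons x m' => exact ⟨m', by simpa using hu⟩
    rw [isReducedList_cons] at hm
    simp only [List.length_cons] at hlen ⊢
    by_cases htu : t * u ∈ (φ i).range
    · obtain ⟨c, hc⟩ := htu
      refine ⟨a * c, m', hm.2.2, by omega, ?_⟩
      rw [map_mul (base φ), mul_assoc, ← of_apply_eq_base φ i c, hc]
      simp [mul_assoc]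
    · exact ⟨a, ⟨i, t * u⟩ :: m', isReducedList_cons.2 ⟨htu, hm.2.1, hm.2.2⟩,
        by simp; omega, by simp [mul_assoc]⟩

theorem IsReducedList.length_le (hφ : ∀ i, Function.Injective (φ i)) {l : List (Σ i, G i)}
    (hl : IsReducedList φ l) {n : ℕ} (h : SyllableLengthLE n (syllableProd φ l)) :
    l.length ≤ n := by
  obtain ⟨a, m, hm, hlen⟩ := h
  obtain ⟨b, m', hm', hlen', heq⟩ := exists_isReducedList (φ := φ) a m
  have := congrArg List.length (hl.map_fst_eq hφ hm' (hm.trans heq))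
  simp only [List.length_map] at this
  omega

theorem SyllableLengthLE.mem_range_or {n : ℕ} {x : PushoutI φ} (h : SyllableLengthLE n x) :
    x ∈ (base φ).range ∨
      ∃ s l, IsReducedList φ (s :: l) ∧ x = syllableProd φ (s :: l) ∧ l.length + 1 ≤ n := by
  obtain ⟨a, m, rfl, hlen⟩ := h
  obtain ⟨b, m', hm', hlen', heq⟩ := exists_isReducedList (φ := φ) a m
  rw [heq]
  cases m' with
  | nil => exact Or.inl ⟨b, by simp⟩
  | cons s l =>
    refine Or.inr ⟨⟨s.1, φ s.1 b * s.2⟩, l, ?_, ?_, ?_⟩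
    · rw [isReducedList_cons] at hm' ⊢
      exact ⟨fun h => hm'.1 ((Subgroup.mul_mem_cancel_left _ (MonoidHom.mem_range.2 ⟨b, rfl⟩)).1 h), hm'.2⟩
    · simp [of_apply_eq_base, mul_assoc]
    · simp at hlen'; omega

theorem exists_syllableLengthLE (x : PushoutI φ) : ∃ n, SyllableLengthLE n x := by
  suffices h : ∃ a l, x = base φ a * syllableProd φ l by
    obtain ⟨a, l, h⟩ := h
    exact ⟨l.length, a, l, h, le_rfl⟩
  have key (l : List (Σ i, G i)) (a : B) :
      ∃ b m, syllableProd φ l * base φ a = base φ b * syllableProd φ m := by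
    induction l with
    | nil => exact ⟨a, [], by simp⟩
    | cons s l ih =>
      obtain ⟨b, m, h⟩ := ih
      exact ⟨1, ⟨s.1, s.2 * φ s.1 b⟩ :: m, by simp [mul_assoc, h, of_apply_eq_base]⟩
  induction x using PushoutI.induction_on with
  | of i g => exact ⟨1, [⟨i, g⟩], by simp⟩
  | base h => exact ⟨h, [], by simp⟩
  | mul x y ihx ihy =>
    obtain ⟨a, l, rfl⟩ := ihx
    obtain ⟨b, m, rfl⟩ := ihy
    obtain ⟨c, k, h⟩ := key l b
    refine ⟨a * c, k ++ m, ?_⟩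
    rw [mul_assoc, ← mul_assoc (syllableProd φ l), h]
    simp [mul_assoc]

/-- If a subgroup has syllable lengths bounded by `n`, every element starts in the same factor as
any element of length exactly `n`. -/
theorem fst_eq_of_syllableLengthLE (hφ : ∀ i, Function.Injective (φ i))
    {K : Subgroup (PushoutI φ)} {s t : Σ i, G i} {l m : List (Σ i, G i)}
    (hK : ∀ x ∈ K, SyllableLengthLE (l.length + 1) x)
    (hl : IsReducedList φ (s :: l)) (hlK : syllableProd φ (s :: l) ∈ K)
    (hm : IsReducedList φ (t :: m)) (hmK : syllableProd φ (t :: m) ∈ K) : s.1 = t.1 := by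
  by_contra hne
  have hred : IsReducedList φ (invSyllables (s :: l) ++ t :: m) :=
    isReducedList_append.2 ⟨hl.invSyllables, hm, by simpa [getLast?_invSyllables] using hne⟩
  have hmem : syllableProd φ (invSyllables (s :: l) ++ t :: m) ∈ K := by
    rw [syllableProd_append, syllableProd_invSyllables]
    exact mul_mem (inv_mem hlK) hmK
  have := hred.length_le hφ (hK _ hmem)
  simp at this

/-- Conjugating by the first syllable of a longest element shortens a bounded subgroup. -/
theorem syllableLengthLE_conj (hφ : ∀ i, Function.Injective (φ i))
    {K : Subgroup (PushoutI φ)} {i : ι} {g : G i} {l : List (Σ i, G i)} (hne : l ≠ [])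
    (hK : ∀ x ∈ K, SyllableLengthLE (l.length + 1) x)
    (hl : IsReducedList φ (⟨i, g⟩ :: l)) (hlK : syllableProd φ (⟨i, g⟩ :: l) ∈ K)
    {x : PushoutI φ} (hx : x ∈ K) :
    SyllableLengthLE l.length ((of i g)⁻¹ * x * of i g) := by
  have hlast (m : List (Σ i, G i)) (s : Σ i, G i) (hm : IsReducedList φ (m ++ [s]))
      (hmK : syllableProd φ (m ++ [s]) ∈ K) : i = s.1 := by
    have h1 := hm.invSyllables
    have h2 : invSyllables (m ++ [s]) = ⟨s.1, s.2⁻¹⟩ :: invSyllables m := by simp [invSyllables]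
    have h3 := inv_mem hmK
    rw [← syllableProd_invSyllables] at h3
    rw [h2] at h1 h3
    exact fst_eq_of_syllableLengthLE (t := ⟨s.1, s.2⁻¹⟩) hφ hK hl hlK h1 h3
  have hlpos : 0 < l.length := List.length_pos_iff.2 hne
  have hlen : 2 ≤ l.length := by
    by_contra! h
    obtain ⟨s, rfl⟩ := List.length_eq_one_iff.1 (show l.length = 1 by omega)
    have := hlast [⟨i, g⟩] s hl hlK
    exact (isReducedList_cons.1 hl).2.1 s (by simp) this
  obtain ⟨a, rfl⟩ | ⟨⟨j, u⟩, m, hm, rfl, hmlen⟩ := (hK x hx).mem_range_or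
  · refine ⟨1, [⟨i, g⁻¹ * φ i a * g⟩], ?_, by simp; omega⟩
    simp [of_apply_eq_base]
  obtain rfl : i = j := fst_eq_of_syllableLengthLE hφ hK hl hlK hm hx
  by_cases h : m.length + 2 ≤ l.length
  · refine ⟨1, ⟨i, g⁻¹ * u⟩ :: (m ++ [⟨i, g⟩]), ?_, by simp; omega⟩
    simp [mul_assoc]
  obtain ⟨a, ha⟩ : g⁻¹ * u ∈ (φ i).range := by
    by_contra hgu
    have hm' := isReducedList_cons.1 hm
    have hl' := isReducedList_cons.1 hl
    have hred : IsReducedList φ (invSyllables l ++ ⟨i, g⁻¹ * u⟩ :: m) := by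
      refine isReducedList_append.2
        ⟨hl'.2.2.invSyllables, isReducedList_cons.2 ⟨hgu, hm'.2⟩, ?_⟩
      rw [getLast?_invSyllables]
      intro s hs t ht
      simp only [Option.mem_def, Option.map_eq_some_iff] at hs
      obtain ⟨r, hr, rfl⟩ := hs
      obtain rfl : (⟨i, g⁻¹ * u⟩ : Σ i, G i) = t := by simpa using ht
      exact (hl'.2.1 r hr).symm
    have hmem : syllableProd φ (invSyllables l ++ ⟨i, g⁻¹ * u⟩ :: m) ∈ K := by
      have := mul_mem (inv_mem hlK) hx
      simpa [mul_assoc] using this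
    have := hred.length_le hφ (hK _ hmem)
    simp only [List.length_append, length_invSyllables, List.length_cons] at this
    omega
  have hconj : (of i g)⁻¹ * syllableProd φ (⟨i, u⟩ :: m) * of i g =
      base φ a * (syllableProd φ m * of i g) := by
    rw [← of_apply_eq_base φ i, ha]
    simp [mul_assoc]
  rw [hconj]
  by_cases h' : m.length + 1 ≤ l.length
  · exact ⟨a, m ++ [⟨i, g⟩], by simp, by simpa using h'⟩
  obtain rfl | ⟨m', ⟨j, v⟩, rfl⟩ := m.eq_nil_or_concat'
  · simp only [List.length_nil] at h'; omega
  obtain rfl : i = j := hlast (⟨i, u⟩ :: m') ⟨j, v⟩ (by simpa using hm) (by simpa using hx)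
  refine ⟨a, m' ++ [⟨i, v * g⟩], by simp [mul_assoc], ?_⟩
  simp at hmlen ⊢
  omega

/-- A subgroup of an amalgamated product with bounded syllable length is conjugate into a
factor. -/
theorem exists_conj_mem_range_of [Nonempty ι] (hφ : ∀ i, Function.Injective (φ i)) (n : ℕ)
    (K : Subgroup (PushoutI φ)) (hK : ∀ x ∈ K, SyllableLengthLE n x) :
    ∃ (i : ι) (c : PushoutI φ), ∀ x ∈ K, c⁻¹ * x * c ∈ (of (φ := φ) i).range := by
  have hbase (i : ι) {x : PushoutI φ} (hx : x ∈ (base φ).range) : x ∈ (of (φ := φ) i).range := by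
    obtain ⟨a, rfl⟩ := hx
    exact ⟨φ i a, of_apply_eq_base φ i a⟩
  induction n generalizing K with
  | zero =>
    refine ⟨Classical.arbitrary ι, 1, fun x hx => ?_⟩
    obtain h | ⟨s, l, -, -, h⟩ := (hK x hx).mem_range_or
    · simpa using hbase _ h
    · omega
  | succ n ih =>
    by_cases hn : ∀ x ∈ K, SyllableLengthLE n x
    · exact ih K hn
    push Not at hn
    obtain ⟨h, hhK, hh⟩ := hn
    obtain ⟨a, rfl⟩ | ⟨⟨i, g⟩, l, hl, rfl, hlen⟩ := (hK h hhK).mem_range_or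
    · exact absurd ⟨a, [], by simp, by simp⟩ hh
    obtain rfl : l.length = n := by
      by_contra hne
      exact hh ⟨1, ⟨i, g⟩ :: l, by simp, by simp; omega⟩
    obtain rfl | hne := eq_or_ne l []
    · refine ⟨i, 1, fun x hx => ?_⟩
      obtain h | ⟨⟨j, u⟩, m, hm, rfl, hmlen⟩ := (hK x hx).mem_range_or
      · simpa using hbase _ h
      · obtain rfl : i = j := fst_eq_of_syllableLengthLE hφ hK hl hhK hm hx
        obtain rfl : m = [] := by simpa using hmlen
        exact ⟨u, by simp⟩
    · obtain ⟨j, c, hc⟩ := ih (K.map (MulAut.conj (of i g)⁻¹).toMonoidHom) (by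
        rintro _ ⟨x, hx, rfl⟩
        simpa using syllableLengthLE_conj hφ hne hK hl hhK hx)
      refine ⟨j, of i g * c, fun x hx => ?_⟩
      have := hc _ ⟨x, hx, rfl⟩
      simpa [mul_assoc] using this

/-- A finite subgroup of an amalgamated product is conjugate into a factor. -/
theorem exists_conj_mem_range_of_finite [Nonempty ι] (hφ : ∀ i, Function.Injective (φ i))
    (K : Subgroup (PushoutI φ)) (hK : (K : Set (PushoutI φ)).Finite) :
    ∃ (i : ι) (c : PushoutI φ), ∀ x ∈ K, c⁻¹ * x * c ∈ (of (φ := φ) i).range := by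
  choose f hf using exists_syllableLengthLE (φ := φ)
  obtain ⟨N, hN⟩ := (hK.image f).bddAbove
  refine exists_conj_mem_range_of hφ N K fun x hx => ?_
  obtain ⟨a, l, h, hlen⟩ := hf x
  exact ⟨a, l, h, hlen.trans (hN ⟨x, hx, rfl⟩)⟩

end Monoid.PushoutI

/-- Two homomorphisms agreeing on the letters of a word agree on the word. -/
theorem FreeGroup.hom_eq_of_forall_mem_toWord {α M : Type*} [DecidableEq α] [Group M]
    {f g : FreeGroup α →* M} {w : FreeGroup α}
    (h : ∀ x ∈ w.toWord, f (FreeGroup.of x.1) = g (FreeGroup.of x.1)) : f w = g w := by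
  rw [← FreeGroup.mk_toWord (x := w)]
  generalize w.toWord = l at h
  induction l with
  | nil => simp [← FreeGroup.one_eq_mk]
  | cons x l ih =>
    simp only [List.forall_mem_cons] at h
    obtain ⟨i, c⟩ := x
    have hx : (FreeGroup.mk ((i, c) :: l)) =
        (bif c then FreeGroup.of i else (FreeGroup.of i)⁻¹) * FreeGroup.mk l := by
      cases c <;> simp [FreeGroup.of, FreeGroup.inv_mk, FreeGroup.mul_mk, FreeGroup.invRev]
    rw [hx, _root_.map_mul, _root_.map_mul, ih h.2]
    cases c <;> simp [h.1]

section PresentedGroup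

open Monoid

/-- A finite subgroup of a free product of cyclic groups is conjugate into one of the given cyclic
factors. -/
theorem PresentedGroup.exists_conj_mem_zpowers {α : Type*} [Nonempty α] {rels : Set (FreeGroup α)}
    (hrels : ∀ w ∈ rels, ∃ (i : α) (k : ℕ), w = FreeGroup.of i ^ k)
    (K : Subgroup (PresentedGroup rels)) (hK : (K : Set (PresentedGroup rels)).Finite) :
    ∃ (i : α) (c : PresentedGroup rels),
      ∀ x ∈ K, c⁻¹ * x * c ∈ Subgroup.zpowers (PresentedGroup.of i : PresentedGroup rels) := by
  let φ : ∀ i : α, Unit →* Subgroup.zpowers (PresentedGroup.of i : PresentedGroup rels) :=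
    fun _ => 1
  let f : PresentedGroup rels →* PushoutI φ :=
    PresentedGroup.toGroup (f := fun i => PushoutI.of i ⟨_, Subgroup.mem_zpowers _⟩) (by
      intro w hw
      obtain ⟨i, k, rfl⟩ := hrels w hw
      rw [map_pow, FreeGroup.lift_apply_of, ← map_pow, SubmonoidClass.mk_pow]
      exact (congrArg _ (Subtype.ext (PresentedGroup.one_of_mem hw))).trans (map_one _))
  let g : PushoutI φ →* PresentedGroup rels :=
    PushoutI.lift (fun i => Subgroup.subtype _) 1 fun i => by ext; simp [φ]
  have hgf (x) : g (f x) = x := by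
    have : g.comp f = MonoidHom.id _ := PresentedGroup.ext fun i => by simp [f, g]
    exact DFunLike.congr_fun this x
  obtain ⟨i, c, hc⟩ := PushoutI.exists_conj_mem_range_of_finite (φ := φ)
    (fun i => Function.injective_of_subsingleton _) (K.map f) (by simpa using hK.image f)
  refine ⟨i, g c, fun x hx => ?_⟩
  obtain ⟨y, hy⟩ := hc _ ⟨x, hx, rfl⟩
  have := congrArg g hy
  simp only [map_mul, map_inv, hgf] at this
  rw [← this]
  simp [g]

end PresentedGroup

namespace FPaper

namespace FTypeBase

variable (D : FTypeBase)

/-- The relators of the two factors, indexed by `Bool`. -/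
def factorRels (b : Bool) : Set (FreeGroup (Fin D.n)) := bif b then D.rels1 else D.rels2

/-- The generator of the amalgamated subgroup, as a word in each factor. -/
def amalgWord (b : Bool) : FreeGroup (Fin D.n) := bif b then D.U else D.V⁻¹

/-- The factor containing a given generator. -/
def side (i : Fin D.n) : Bool := decide ((i : ℕ) < D.p)

/-- The embeddings of the amalgamated subgroup in the two factors. -/
def amalgHom (b : Bool) : Multiplicative ℤ →* PresentedGroup (D.factorRels b) :=
  zpowersHom _ (PresentedGroup.mk _ (D.amalgWord b))

theorem mem_factorRels {b : Bool} {w : FreeGroup (Fin D.n)} :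
    w ∈ D.factorRels b ↔
      (∃ i, D.side i = b ∧ w = FreeGroup.of i ^ D.e i) ∨
        ∃ i, D.side i ≠ b ∧ w = FreeGroup.of i := by
  cases b <;> simp [factorRels, rels1, rels2, side]

variable {D}

theorem amalgHom_injective (h₁ : ¬ IsOfFinOrder D.imgU1) (h₂ : ¬ IsOfFinOrder D.imgV2)
    (b : Bool) : Function.Injective (D.amalgHom b) := by
  have h : ¬ IsOfFinOrder (PresentedGroup.mk (D.factorRels b) (D.amalgWord b)) := by
    cases b
    · rw [amalgWord, cond_false, map_inv, isOfFinOrder_inv_iff]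
      exact h₂
    · exact h₁
  intro x y hxy
  exact injective_zpow_iff_not_isOfFinOrder.2 h hxy

/-- The map from an F-type group to the amalgam of its factors. -/
theorem exists_toPushout (hU : ∀ x ∈ D.U.toWord, (x.1 : ℕ) < D.p)
    (hV : ∀ x ∈ D.V.toWord, D.p ≤ (x.1 : ℕ)) :
    ∃ f : D.Gp →* Monoid.PushoutI D.amalgHom,
      ∀ i, f (PresentedGroup.of i) = Monoid.PushoutI.of (D.side i) (PresentedGroup.of i) := by
  let F : FreeGroup (Fin D.n) →* Monoid.PushoutI D.amalgHom :=
    FreeGroup.lift fun i => Monoid.PushoutI.of (D.side i) (PresentedGroup.of i)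
  have key (b : Bool) (w : FreeGroup (Fin D.n)) (hw : ∀ x ∈ w.toWord, D.side x.1 = b) :
      F w = Monoid.PushoutI.of b (PresentedGroup.mk _ w) := by
    refine FreeGroup.hom_eq_of_forall_mem_toWord
      (f := F) (g := (Monoid.PushoutI.of (φ := D.amalgHom) b).comp (PresentedGroup.mk _)) fun x hx => ?_
    obtain rfl := hw x hx
    simp [F, PresentedGroup.of]
  have hbase (b : Bool) :
      Monoid.PushoutI.of b (PresentedGroup.mk _ (D.amalgWord b)) =
        Monoid.PushoutI.base D.amalgHom (Multiplicative.ofAdd 1) := by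
    rw [← Monoid.PushoutI.of_apply_eq_base _ b]
    simp [amalgHom]
  refine ⟨PresentedGroup.toGroup (f := fun i =>
    Monoid.PushoutI.of (D.side i) (PresentedGroup.of i)) ?_, fun i => PresentedGroup.toGroup.of _⟩
  rintro w (⟨i, rfl⟩ | rfl)
  · rw [map_pow, FreeGroup.lift_apply_of, ← map_pow, PresentedGroup.of, ← map_pow,
      PresentedGroup.one_of_mem, map_one]
    exact (D.mem_factorRels).2 (Or.inl ⟨i, rfl, rfl⟩)
  · change F _ = 1
    rw [map_mul, key true D.U (fun x hx => decide_eq_true (hU x hx)),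
      key false D.V (fun x hx => decide_eq_false (hV x hx).not_gt)]
    have h₁ := hbase true
    have h₂ := hbase false
    rw [amalgWord, cond_false, map_inv, map_inv, inv_eq_iff_eq_inv] at h₂
    rw [amalgWord, cond_true] at h₁
    rw [h₁, h₂, mul_inv_cancel]

/-- The map from a factor to the F-type group. -/
theorem exists_factor_hom (b : Bool) :
    ∃ g : PresentedGroup (D.factorRels b) →* D.Gp,
      ∀ i, g (PresentedGroup.of i) = if D.side i = b then PresentedGroup.of i else 1 := by
  refine ⟨PresentedGroup.toGroup (f := fun i =>
    if D.side i = b then PresentedGroup.of i else 1) ?_, fun i => PresentedGroup.toGroup.of _⟩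
  intro w hw
  obtain ⟨i, hi, rfl⟩ | ⟨i, hi, rfl⟩ := D.mem_factorRels.1 hw
  · rw [map_pow, FreeGroup.lift_apply_of, if_pos hi, PresentedGroup.of, ← map_pow]
    exact PresentedGroup.one_of_mem (Or.inl ⟨i, rfl⟩)
  · rw [FreeGroup.lift_apply_of, if_neg hi]

/-- The map from the amalgam of its factors to an F-type group. -/
theorem exists_ofPushout (hU : ∀ x ∈ D.U.toWord, (x.1 : ℕ) < D.p)
    (hV : ∀ x ∈ D.V.toWord, D.p ≤ (x.1 : ℕ)) :
    ∃ g : Monoid.PushoutI D.amalgHom →* D.Gp, ∀ b i,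
      g (Monoid.PushoutI.of b (PresentedGroup.of i)) =
        if D.side i = b then PresentedGroup.of i else 1 := by
  choose g hg using D.exists_factor_hom
  have key (b : Bool) (w : FreeGroup (Fin D.n)) (hw : ∀ x ∈ w.toWord, D.side x.1 = b) :
      g b (PresentedGroup.mk _ w) = PresentedGroup.mk _ w := by
    refine FreeGroup.hom_eq_of_forall_mem_toWord
      (f := (g b).comp (PresentedGroup.mk _)) fun x hx => ?_
    obtain rfl := hw x hx
    exact (hg _ x.1).trans (if_pos rfl)
  have hword (b : Bool) : g b (PresentedGroup.mk _ (D.amalgWord b)) =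
      PresentedGroup.mk D.rels D.U := by
    cases b
    · have hUV : PresentedGroup.mk D.rels (D.U * D.V) = 1 := PresentedGroup.one_of_mem (Or.inr rfl)
      rw [amalgWord, cond_false, map_inv, map_inv,
        key false D.V fun x hx => decide_eq_false (hV x hx).not_gt]
      rw [map_mul] at hUV
      exact (eq_inv_of_mul_eq_one_left hUV).symm
    · exact key true D.U fun x hx => decide_eq_true (hU x hx)
  refine ⟨Monoid.PushoutI.lift g (zpowersHom _ (PresentedGroup.mk D.rels D.U)) fun b => ?_,
    fun b i => by simp [hg]⟩
  ext
  simp [amalgHom, hword]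

end FTypeBase

/-- Every finite subgroup of a group of F-type is cyclic and conjugate to a
subgroup of `⟨a_i⟩` for some generator `a_i`. -/
theorem fType_finite_subgroups (D : FTypeBase) (hD : D.IsFType)
    (H : Subgroup D.Gp) (hH : (H : Set D.Gp).Finite) :
    IsCyclic H ∧ ∃ (i : Fin D.n) (g : D.Gp),
      ∀ x ∈ H, g⁻¹ * x * g ∈ Subgroup.zpowers (PresentedGroup.of i : D.Gp) := by
  obtain ⟨hn, -, -, -, hU, hV, -, -, h₁, h₂, -, -⟩ := hD
  have : Nonempty (Fin D.n) := ⟨⟨0, by omega⟩⟩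
  suffices h : ∃ (i : Fin D.n) (g : D.Gp),
      ∀ x ∈ H, g⁻¹ * x * g ∈ Subgroup.zpowers (PresentedGroup.of i : D.Gp) by
    refine ⟨?_, h⟩
    obtain ⟨i, g, hg⟩ := h
    refine isCyclic_of_injective
      (((MulAut.conj g⁻¹).toMonoidHom.comp H.subtype).codRestrict
        (Subgroup.zpowers (PresentedGroup.of i : D.Gp)) fun x => by simpa using hg x x.2) ?_
    intro x y hxy
    simpa using congrArg Subtype.val hxy
  obtain ⟨f, hf⟩ := FTypeBase.exists_toPushout hU hV
  obtain ⟨r, hr⟩ := FTypeBase.exists_ofPushout hU hV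
  have hrf (x) : r (f x) = x := by
    have : r.comp f = MonoidHom.id _ := PresentedGroup.ext fun i => by simp [hf, hr]
    exact DFunLike.congr_fun this x
  obtain ⟨b, c, hc⟩ := Monoid.PushoutI.exists_conj_mem_range_of_finite
    (FTypeBase.amalgHom_injective h₁ h₂) (H.map f) (by simpa using hH.image f)
  have hinj := Monoid.PushoutI.of_injective (FTypeBase.amalgHom_injective h₁ h₂) b
  let K : Subgroup (PresentedGroup (D.factorRels b)) :=
    ((H.map f).map (MulAut.conj c⁻¹).toMonoidHom).comap
      (Monoid.PushoutI.of (φ := D.amalgHom) b)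
  have hK : (K : Set (PresentedGroup (D.factorRels b))).Finite := by
    rw [Subgroup.coe_comap]
    exact ((hH.image f).image _).preimage hinj.injOn
  obtain ⟨i, d, hd⟩ := PresentedGroup.exists_conj_mem_zpowers (fun w hw => by
    obtain ⟨i, -, rfl⟩ | ⟨i, -, rfl⟩ := D.mem_factorRels.1 hw
    · exact ⟨i, _, rfl⟩
    · exact ⟨i, 1, (pow_one _).symm⟩) K hK
  refine ⟨i, r (c * Monoid.PushoutI.of b d), fun x hx => ?_⟩
  obtain ⟨y, hy⟩ := hc _ ⟨x, hx, rfl⟩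
  obtain ⟨k, hk⟩ := hd y ⟨f x, ⟨x, hx, rfl⟩, by simp [hy]⟩
  have hmem : r (Monoid.PushoutI.of b (PresentedGroup.of i)) ∈
      Subgroup.zpowers (PresentedGroup.of i : D.Gp) := by
    rw [hr]
    split_ifs
    · exact Subgroup.mem_zpowers _
    · exact one_mem _
  have heq : (r (c * Monoid.PushoutI.of b d))⁻¹ * x * r (c * Monoid.PushoutI.of b d) =
      r (Monoid.PushoutI.of b (PresentedGroup.of i)) ^ k := by
    rw [← map_zpow, ← map_zpow]
    dsimp only at hk
    rw [hk]
    simp [hy, hrf, mul_assoc]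
  rw [heq]
  exact zpow_mem hmem k

end FPaper
end
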